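/- arXiv:2503.10320 — 10 statements merged into one kernel-verified Lean document; each statement's English description precedes it below -/
import Mathlib

section
/- Let Σ be a finite alphabet with q ≥ 2 symbols, let d ≥ 2, and let f : Σ^d → Σ be a bipermutive local rule. Consider the no-boundary cellular automaton F : Σ^{2(d-1)} → Σ^{d-1} induced by f, and define its Cayley table C_F : Σ^{d-1} × Σ^{d-1} → Σ^{d-1} by C_F(u,v) = F(u‖v), where u‖v denotes concatenation. Then C_F is a Latin square of order q^{d-1}; that is, for every u ∈ Σ^{d-1} the maps v ↦ C_F(u,v) and v ↦ C_F(v,u) are bijections of Σ^{d-1}. Equivalently, (Σ^{d-1}, C_F) is a quasigroup of order q^{d-1}. -/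
/-- `f` is permutive in coordinate `i`: fixing all other coordinates, the map in the
`i`-th coordinate is a bijection of the alphabet. -/
def PermutiveAt {A : Type*} {d : ℕ} (f : (Fin d → A) → A) (i : Fin d) : Prop :=
  ∀ x : Fin d → A, Function.Bijective fun a : A => f (Function.update x i a)

/-- A local rule of diameter `d ≥ 2` is bipermutive if it is both leftmost and
rightmost permutive. -/
def Bipermutive {A : Type*} {d : ℕ} (hd : 2 ≤ d) (f : (Fin d → A) → A) : Prop :=
  PermutiveAt f ⟨0, by omega⟩ ∧ PermutiveAt f ⟨d - 1, by omega⟩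

/-- The no-boundary CA `F : Σ^{2(d-1)} → Σ^{d-1}` induced by a local rule of diameter `d`. -/
def caF {A : Type*} (d : ℕ) (f : (Fin d → A) → A) (x : Fin (2 * (d - 1)) → A) :
    Fin (d - 1) → A :=
  fun i => f fun j => x ⟨i.1 + j.1, by have := i.isLt; have := j.isLt; omega⟩

/-- Concatenation of two blocks of length `d-1`. -/
def concat {A : Type*} (d : ℕ) (u v : Fin (d - 1) → A) : Fin (2 * (d - 1)) → A :=
  fun i =>
    if h : i.1 < d - 1 then u ⟨i.1, h⟩
    else v ⟨i.1 - (d - 1), by have := i.isLt; omega⟩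

/-- The Cayley table of the CA induced by `f`: `C_F(u,v) = F(u‖v)`. -/
def cayley {A : Type*} (d : ℕ) (f : (Fin d → A) → A) (u v : Fin (d - 1) → A) :
    Fin (d - 1) → A :=
  caF d f (concat d u v)

theorem perm_aux {A : Type*} {d : ℕ} {f : (Fin d → A) → A} {i : Fin d}
    (h : PermutiveAt f i) {x y : Fin d → A} (hxy : ∀ j, j ≠ i → x j = y j)
    (e : f x = f y) : x i = y i := by
  apply (h x).1
  have h2 : Function.update x i (y i) = y := by
    funext j
    by_cases hj : j = i
    · subst hj; simp
    · simp [hj, hxy j hj]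
  simp only [Function.update_eq_self, h2, e]

/-- The Cayley table of a bipermutive CA is a Latin square of order `q^{d-1}`:
each row map and each column map is a bijection of `Σ^{d-1}`, a set of size `q^{d-1}`.
Equivalently, `(Σ^{d-1}, C_F)` is a quasigroup of order `q^{d-1}`. -/
theorem stmt0 {A : Type*} [Fintype A] (q d : ℕ) (hq : 2 ≤ q) (hA : Fintype.card A = q)
    (hd : 2 ≤ d) (f : (Fin d → A) → A) (hf : Bipermutive hd f) :
    Fintype.card (Fin (d - 1) → A) = q ^ (d - 1) ∧
    ∀ u : Fin (d - 1) → A,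
      Function.Bijective (fun v => cayley d f u v) ∧
      Function.Bijective (fun v => cayley d f v u) := by
  refine ⟨by simp [hA], fun u => ⟨?_, ?_⟩⟩
  · refine Finite.injective_iff_bijective.1 fun v w e => ?_
    have key : ∀ k (hk : k < d - 1), v ⟨k, hk⟩ = w ⟨k, hk⟩ := by
      intro k
      induction k using Nat.strong_induction_on with
      | _ k ih =>
        intro hk
        have e1 := perm_aux hf.2 ?_ (congrFun e ⟨k, hk⟩)
        · simpa [concat] using e1
        · intro j hj
          have hj' : j.1 ≠ d - 1 := fun h => hj (Fin.ext h)
          have := j.isLt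
          simp only [concat]
          split_ifs with h
          · rfl
          · exact ih _ (by omega) _
    funext k
    exact key k.1 k.2
  · refine Finite.injective_iff_bijective.1 fun v w e => ?_
    have key : ∀ m k (hk : k < d - 1), d - 1 - k = m → v ⟨k, hk⟩ = w ⟨k, hk⟩ := by
      intro m
      induction m using Nat.strong_induction_on with
      | _ m ih =>
        intro k hk hm
        have e1 := perm_aux hf.1 ?_ (congrFun e ⟨k, hk⟩)
        · simpa [concat, hk] using e1
        · intro j hj
          have hj' : j.1 ≠ 0 := fun h => hj (Fin.ext h)
          simp only [concat]
          split_ifs with h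
          · exact ih _ (by omega) _ _ rfl
          · rfl
    funext k
    exact key _ k.1 k.2 rfl
end

section
/- Let q be a prime power, d ≥ 2, and let F, G : F_q^{2(d-1)} → F_q^{d-1} be the no-boundary cellular automata induced by linear bipermutive local rules f(x) = a_1x_1 + ⋯ + a_dx_d and g(x) = b_1x_1 + ⋯ + b_dx_d (with a_1, a_d, b_1, b_d ≠ 0), and let p_f(X) = a_1 + a_2X + ⋯ + a_dX^{d-1}, p_g(X) = b_1 + b_2X + ⋯ + b_dX^{d-1} be the associated polynomials. Then the Cayley tables C_F and C_G, which are Latin squares of order q^{d-1}, are orthogonal if and only if gcd(p_f, p_g) = 1. -/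
/-- Two local rules generate orthogonal Latin squares iff the superposition
`(u,v) ↦ (C_F(u,v), C_G(u,v))` is a bijection. -/
def Orthogonal {A : Type*} (d : ℕ) (f g : (Fin d → A) → A) : Prop :=
  Function.Bijective fun p : (Fin (d - 1) → A) × (Fin (d - 1) → A) =>
    (cayley d f p.1 p.2, cayley d g p.1 p.2)

/-- The linear local rule with coefficients `a₁,…,a_d`. -/
def linRule {K : Type*} [Field K] {d : ℕ} (a : Fin d → K) : (Fin d → K) → K :=
  fun x => ∑ i, a i * x i

/-- The polynomial `p(X) = a₁ + a₂X + ⋯ + a_dX^{d-1}` associated to a linear rule. -/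
noncomputable def assocPoly {K : Type*} [Field K] {d : ℕ} (a : Fin d → K) : Polynomial K :=
  ∑ i, Polynomial.C (a i) * Polynomial.X ^ (i : ℕ)

open Polynomial in
theorem aux_coeff {K : Type*} [Field K] {d : ℕ} (a : Fin d → K) (n : ℕ) :
    (assocPoly a).coeff n = if h : n < d then a ⟨n, h⟩ else 0 := by
  unfold assocPoly
  simp only [finsetSum_coeff, coeff_C_mul, coeff_X_pow]
  split_ifs with h
  · rw [Finset.sum_eq_single ⟨n, h⟩]
    · simp
    · intro b _ hb
      have : n ≠ b := fun e => hb (Fin.ext e.symm)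
      simp [this]
    · simp
  · apply Finset.sum_eq_zero
    intro b _
    have : n ≠ b := by have := b.isLt; omega
    simp [this]

theorem aux_natDegree {K : Type*} [Field K] {k : ℕ} (a : Fin (k + 1) → K)
    (h : a ⟨k, by omega⟩ ≠ 0) : (assocPoly a).natDegree = k := by
  apply Polynomial.natDegree_eq_of_le_of_coeff_ne_zero
  · rw [Polynomial.natDegree_le_iff_coeff_eq_zero]
    intro n hn
    rw [aux_coeff, dif_neg (by omega)]
  · rw [aux_coeff, dif_pos (by omega)]
    exact h

theorem aux_sum {K : Type*} [Field K] {k : ℕ} (a : Fin (k + 1) → K)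
    (u v : Fin k → K) (i : Fin k) :
    cayley (k + 1) (linRule a) u v i = ∑ j : Fin (k + k), Fin.append u v j *
      (if (j : ℕ) ∈ Set.Icc (i : ℕ) (i + k) then (assocPoly a).coeff (j - i) else 0) := by
  unfold cayley caF linRule
  apply Finset.sum_of_injOn (fun j : Fin (k + 1) => (⟨i + j, by omega⟩ : Fin (k + k)))
  · intro x _ y _ h
    simp only [Fin.mk.injEq] at h
    ext; omega
  · simp
  · intro j _ hj
    rw [if_neg, mul_zero]
    rintro ⟨h1, h2⟩
    apply hj
    refine ⟨⟨j - i, by omega⟩, by simp, ?_⟩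
    ext
    simp only
    omega
  · intro j _
    have hj := j.isLt
    rw [if_pos (by simp only [Set.mem_Icc]; omega), aux_coeff, dif_pos (by simp only; omega), mul_comm]
    congr 1
    · unfold concat
      simp only [Fin.append, Fin.addCases]
      split_ifs with h1 h2 h2
      · rfl
      · exact absurd h1 h2
      · exact absurd h2 h1
      · simp
    · congr 1
      ext
      simp

/-- The Latin squares generated by two linear bipermutive CA over `F_q` are orthogonal
iff the associated polynomials are coprime. -/
theorem stmt5 {K : Type*} [Field K] [Fintype K] {d : ℕ} (hd : 2 ≤ d)
    (a b : Fin d → K)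
    (ha1 : a ⟨0, by omega⟩ ≠ 0) (had : a ⟨d - 1, by omega⟩ ≠ 0)
    (hb1 : b ⟨0, by omega⟩ ≠ 0) (hbd : b ⟨d - 1, by omega⟩ ≠ 0) :
    Orthogonal d (linRule a) (linRule b) ↔ IsCoprime (assocPoly a) (assocPoly b) := by
  obtain ⟨k, rfl⟩ : ∃ k, d = k + 1 := ⟨d - 1, by omega⟩
  have hA : (assocPoly a).natDegree = k := aux_natDegree a had
  have hB : (assocPoly b).natDegree = k := aux_natDegree b hbd
  have hA0 : assocPoly a ≠ 0 := by
    intro h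
    rw [h] at hA
    simp at hA
    omega
  have hR := Polynomial.resultant_eq_zero_iff (f := assocPoly b) (g := assocPoly a)
  rw [hA, hB] at hR
  set S := Polynomial.sylvester (assocPoly b) (assocPoly a) k k with hS
  have hcomm : ∀ p : (Fin k → K) × (Fin k → K),
      Fin.append (cayley (k + 1) (linRule a) p.1 p.2) (cayley (k + 1) (linRule b) p.1 p.2)
        = Matrix.vecMul (Fin.append p.1 p.2) S := by
    intro p
    funext j
    refine Fin.addCases (fun i => ?_) (fun i => ?_) j
    · refine (Fin.append_left _ _ i).trans ?_
      rw [aux_sum]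
      simp [Matrix.vecMul, dotProduct, hS, Polynomial.sylvester]
    · refine (Fin.append_right _ _ i).trans ?_
      rw [aux_sum]
      refine Finset.sum_congr rfl fun x _ => ?_
      congr 1
      have key : ∀ i : Fin k, S x (Fin.natAdd k i) =
          if (x : ℕ) ∈ Set.Icc (i : ℕ) (i + k) then (assocPoly b).coeff (x - i) else 0 := by
        intro i
        simp only [hS, Polynomial.sylvester, Matrix.of_apply, Fin.addCases_right]
      exact (key i).symm
  have hdet : IsCoprime (assocPoly a) (assocPoly b) ↔ S.det ≠ 0 := by
    rw [Ne, show S.det = Polynomial.resultant (assocPoly b) (assocPoly a) k k from rfl, hR,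
      isCoprime_comm]
    tauto
  have hbij : Orthogonal (k + 1) (linRule a) (linRule b) ↔
      Function.Bijective (fun x => Matrix.vecMul x S) := by
    unfold Orthogonal
    rw [← Function.Bijective.of_comp_iff' (Fin.appendEquiv (α := K) k k).bijective,
      ← Function.Bijective.of_comp_iff (fun x => Matrix.vecMul x S)
        (Fin.appendEquiv (α := K) k k).bijective]
    have : (⇑(Fin.appendEquiv (α := K) k k) ∘ fun p : (Fin k → K) × (Fin k → K) =>
        (cayley (k + 1) (linRule a) p.1 p.2, cayley (k + 1) (linRule b) p.1 p.2))
        = (fun x => Matrix.vecMul x S) ∘ ⇑(Fin.appendEquiv (α := K) k k) :=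
      funext hcomm
    exact iff_of_eq (congrArg Function.Bijective this)
  rw [hbij, hdet, ← isUnit_iff_ne_zero, ← Matrix.isUnit_iff_isUnit_det]
  exact ⟨fun h => Matrix.vecMul_injective_iff_isUnit.1 h.1, fun h =>
    ⟨Matrix.vecMul_injective_iff_isUnit.2 h, Matrix.vecMul_surjective_iff_isUnit.2 h⟩⟩
end

section
/- Let q be a prime power and n ≥ 1. The number of unordered pairs {p, g} of distinct coprime monic polynomials over F_q, both of degree n and both with nonzero constant term, equals a_n = (1/2)·( q(q-1)^3 · (q^{2n-2} - 1)/(q^2 - 1) + (q-1)(q-2) ). Equivalently, this is the number of unordered pairs of orthogonal Latin squares generated by linear bipermutive cellular automata of diameter d = n+1 over F_q. -/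
open Polynomial in
/-- the monic polynomials of degree n, as functions -/
noncomputable def auxEquiv (K : Type*) [Field K] (n : ℕ) :
    ({p : K[X] | p.Monic ∧ p.natDegree = n} : Set K[X]) ≃ (Fin n → K) :=
  ((Equiv.subtypeEquivRight (fun p => by simp)).trans
    (Polynomial.monicEquivDegreeLT (R := K) n)).trans (Polynomial.degreeLTEquiv K n).toEquiv

open Polynomial in
lemma aux_fin (K : Type*) [Field K] [Fintype K] (n : ℕ) :
    {p : K[X] | p.Monic ∧ p.natDegree = n}.Finite := by
  have := Finite.of_equiv _ (auxEquiv K n).symm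
  exact Set.toFinite _

open Polynomial in
lemma aux_card (K : Type*) [Field K] [Fintype K] (n : ℕ) :
    (aux_fin K n).toFinset.card = Fintype.card K ^ n := by
  rw [← Set.ncard_eq_toFinset_card _ (aux_fin K n), ← Nat.card_coe_set_eq,
    Nat.card_congr (auxEquiv K n)]
  simp

open Polynomial in
lemma aux_finM (K : Type*) [Field K] [Fintype K] (n : ℕ) :
    {p : K[X] | p.Monic ∧ p.natDegree = n ∧ p.coeff 0 ≠ 0}.Finite :=
  (aux_fin K n).subset fun _ h => ⟨h.1, h.2.1⟩

open Polynomial in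
/-- monic, degree n, nonzero constant term -/
noncomputable def auxM (K : Type*) [Field K] [Fintype K] (n : ℕ) : Finset K[X] :=
  (aux_finM K n).toFinset

open Polynomial in
lemma mem_auxM {K : Type*} [Field K] [Fintype K] {n : ℕ} {p : K[X]} :
    p ∈ auxM K n ↔ p.Monic ∧ p.natDegree = n ∧ p.coeff 0 ≠ 0 := by
  simp [auxM]

open Polynomial in
lemma auxM_zero (K : Type*) [Field K] [Fintype K] : auxM K 0 = {1} := by
  ext p
  rw [mem_auxM, Finset.mem_singleton]
  constructor
  · rintro ⟨h, h1, -⟩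
    exact h.natDegree_eq_zero.1 h1
  · rintro rfl
    simp

open Polynomial in
lemma auxM_succ (K : Type*) [Field K] [Fintype K] (n : ℕ) :
    (auxM K (n+1)).card = (Fintype.card K - 1) * Fintype.card K ^ n := by
  classical
  have h0 : ((Finset.univ : Finset K).erase 0).card = Fintype.card K - 1 := by
    rw [Finset.card_erase_of_mem (Finset.mem_univ _), Finset.card_univ]
  rw [← aux_card, ← h0, ← Finset.card_product]
  symm
  have hdeg : ∀ (x : K × K[X]), x.2.Monic → (X * x.2 + C x.1).natDegree = x.2.natDegree + 1 := by
    intro x hx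
    rw [natDegree_add_C, natDegree_X_mul hx.ne_zero]
  refine Finset.card_bij (fun x _ => X * x.2 + C x.1) ?_ ?_ ?_
  · rintro ⟨a, h⟩ hx
    simp only [Finset.mem_product, Finset.mem_erase, Finset.mem_univ, and_true,
      Set.Finite.mem_toFinset, Set.mem_ofPred_eq] at hx
    obtain ⟨ha, hm, hd⟩ := hx
    rw [mem_auxM]
    refine ⟨?_, by rw [hdeg (a, h) hm, hd], by simpa using ha⟩
    rw [Monic, leadingCoeff, hdeg (a, h) hm]
    simpa [coeff_C] using hm.leadingCoeff
  · rintro ⟨a, h⟩ _ ⟨b, g⟩ _ he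
    have e1 : a = b := by simpa using congrArg (fun p => coeff p 0) he
    have e2 : h = g := by
      ext i
      simpa [coeff_C] using congrArg (fun p => coeff p (i+1)) he
    rw [e1, e2]
  · intro p hp
    rw [mem_auxM] at hp
    obtain ⟨hm, hd, h0⟩ := hp
    refine ⟨(p.coeff 0, p.divX), ?_, X_mul_divX_add p⟩
    simp only [Finset.mem_product, Finset.mem_erase, Finset.mem_univ, and_true,
      Set.Finite.mem_toFinset, Set.mem_ofPred_eq]
    have hd' : p.divX.natDegree = n := by rw [natDegree_divX_eq_natDegree_tsub_one, hd]; rfl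
    refine ⟨h0, ?_, hd'⟩
    rw [Monic, leadingCoeff, hd', coeff_divX, ← hd]
    exact hm

open Polynomial Classical in
/-- ordered coprime pairs -/
noncomputable def auxA (K : Type*) [Field K] [Fintype K] (n : ℕ) : Finset (K[X] × K[X]) :=
  (auxM K n ×ˢ auxM K n).filter fun x => IsCoprime x.1 x.2

open Polynomial in
lemma mem_auxA {K : Type*} [Field K] [Fintype K] {n : ℕ} {x : K[X] × K[X]} :
    x ∈ auxA K n ↔ (x.1 ∈ auxM K n ∧ x.2 ∈ auxM K n) ∧ IsCoprime x.1 x.2 := by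
  simp [auxA]

open Polynomial in
lemma auxM_mul {K : Type*} [Field K] [Fintype K] {k l : ℕ} {p g : K[X]}
    (hp : p ∈ auxM K k) (hg : g ∈ auxM K l) : p * g ∈ auxM K (k + l) := by
  rw [mem_auxM] at *
  exact ⟨hp.1.mul hg.1, by rw [hp.1.natDegree_mul hg.1, hp.2.1, hg.2.1],
    by rw [mul_coeff_zero]; exact mul_ne_zero hp.2.2 hg.2.2⟩

open Polynomial in
lemma auxM_of_mul {K : Type*} [Field K] [Fintype K] {n : ℕ} {p g : K[X]}
    (hp : p.Monic) (h : p * g ∈ auxM K n) :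
    p.natDegree ≤ n ∧ p ∈ auxM K p.natDegree ∧ g ∈ auxM K (n - p.natDegree) := by
  rw [mem_auxM] at *
  obtain ⟨h1, h2, h3⟩ := h
  have hg : g.Monic := hp.of_mul_monic_left h1
  rw [hp.natDegree_mul hg] at h2
  rw [mul_coeff_zero] at h3
  rw [mem_auxM]
  exact ⟨by omega, ⟨hp, rfl, left_ne_zero_of_mul h3⟩, hg, by omega, right_ne_zero_of_mul h3⟩

open Polynomial in
lemma aux_dvd {K : Type*} [Field K] {d e a b a' b' : K[X]}
    (h : IsCoprime a' b') (h1 : d * a = e * a') (h2 : d * b = e * b') : d ∣ e := by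
  obtain ⟨u, v, huv⟩ := h
  refine ⟨u * a + v * b, ?_⟩
  linear_combination (-e) * huv - u * h1 - v * h2

open Polynomial in
lemma aux_rec (K : Type*) [Field K] [Fintype K] (n : ℕ) :
    ∑ k ∈ Finset.range (n+1), (auxM K k).card * (auxA K (n-k)).card = (auxM K n).card ^ 2 := by
  classical
  rw [sq, ← Finset.card_product]
  simp_rw [← Finset.card_product]
  rw [← Finset.card_sigma]
  refine Finset.card_bij (fun x _ => (x.2.1 * x.2.2.1, x.2.1 * x.2.2.2)) ?_ ?_ ?_
  · rintro ⟨k, d, a, b⟩ hx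
    simp only [Finset.mem_sigma, Finset.mem_range, Finset.mem_product, mem_auxA] at hx ⊢
    obtain ⟨hk, hd, ⟨ha, hb⟩, -⟩ := hx
    have e : k + (n - k) = n := by omega
    exact ⟨e ▸ auxM_mul hd ha, e ▸ auxM_mul hd hb⟩
  · rintro ⟨k, d, a, b⟩ hx ⟨k', d', a', b'⟩ hx' he
    simp only [Finset.mem_sigma, Finset.mem_range, Finset.mem_product, mem_auxA] at hx hx'
    simp only [Prod.mk.injEq] at he
    obtain ⟨hk, hd, ⟨ha, hb⟩, hc⟩ := hx
    obtain ⟨hk', hd', ⟨ha', hb'⟩, hc'⟩ := hx'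
    rw [mem_auxM] at hd hd'
    have e : d = d' := eq_of_monic_of_associated hd.1 hd'.1
      (associated_of_dvd_dvd (aux_dvd hc' he.1 he.2) (aux_dvd hc he.1.symm he.2.symm))
    subst e
    have ea := mul_left_cancel₀ hd.1.ne_zero he.1
    have eb := mul_left_cancel₀ hd.1.ne_zero he.2
    have ek : k = k' := by rw [← hd.2.1, hd'.2.1]
    subst ea eb ek
    rfl
  · rintro ⟨p, g⟩ hx
    rw [Finset.mem_product] at hx
    obtain ⟨hp, hg⟩ := hx
    dsimp only at hp hg
    have hp0 : p ≠ 0 := (mem_auxM.1 hp).1.ne_zero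
    have hG : EuclideanDomain.gcd p g ≠ 0 := fun h => hp0 (EuclideanDomain.gcd_eq_zero_iff.1 h).1
    obtain ⟨a, ha⟩ := EuclideanDomain.gcd_dvd_left p g
    obtain ⟨b, hb⟩ := EuclideanDomain.gcd_dvd_right p g
    have hbez := EuclideanDomain.gcd_eq_gcd_ab p g
    set G := EuclideanDomain.gcd p g with hGdef
    have hcop : IsCoprime a b := by
      refine ⟨EuclideanDomain.gcdA p g, EuclideanDomain.gcdB p g, mul_left_cancel₀ hG ?_⟩
      linear_combination (-EuclideanDomain.gcdA p g) * ha - (EuclideanDomain.gcdB p g) * hb - hbez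
    have hl : G.leadingCoeff ≠ 0 := leadingCoeff_ne_zero.2 hG
    have hmon : (G * C G.leadingCoeff⁻¹).Monic := monic_mul_leadingCoeff_inv hG
    have hCC : C G.leadingCoeff⁻¹ * C G.leadingCoeff = 1 := by
      rw [← C_mul, inv_mul_cancel₀ hl, C_1]
    have hu : IsUnit (C G.leadingCoeff) := isUnit_C.2 hl.isUnit
    have ep : p = (G * C G.leadingCoeff⁻¹) * (C G.leadingCoeff * a) := by
      linear_combination ha - G * a * hCC
    have eg : g = (G * C G.leadingCoeff⁻¹) * (C G.leadingCoeff * b) := by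
      linear_combination hb - G * b * hCC
    rw [ep] at hp
    rw [eg] at hg
    obtain ⟨h1, h2, h3⟩ := auxM_of_mul hmon hp
    obtain ⟨-, -, h4⟩ := auxM_of_mul hmon hg
    refine ⟨⟨(G * C G.leadingCoeff⁻¹).natDegree, G * C G.leadingCoeff⁻¹,
      C G.leadingCoeff * a, C G.leadingCoeff * b⟩, ?_, ?_⟩
    · simp only [Finset.mem_sigma, Finset.mem_range, Finset.mem_product, mem_auxA]
      refine ⟨by omega, h2, ⟨h3, h4⟩, ?_⟩
      rw [isCoprime_mul_unit_left_left hu, isCoprime_mul_unit_left_right hu]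
      exact hcop
    · exact Prod.ext ep.symm eg.symm

lemma auxA_zero (K : Type*) [Field K] [Fintype K] : (auxA K 0).card = 1 := by
  have := aux_rec K 0
  simpa [auxM_zero] using this

lemma auxM_succ' (K : Type*) [Field K] [Fintype K] (n : ℕ) :
    ((auxM K (n+1)).card : ℚ) = ((Fintype.card K : ℚ) - 1) * (Fintype.card K : ℚ) ^ n := by
  rw [auxM_succ]
  push_cast [Nat.cast_sub Fintype.card_pos]
  rfl

lemma auxA_step (K : Type*) [Field K] [Fintype K] (n : ℕ) :
    ((auxA K (n+1)).card : ℚ) = (auxA K n).card + ((auxM K (n+1)).card : ℚ) ^ 2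
      - Fintype.card K * ((auxM K n).card : ℚ) ^ 2 := by
  have h1 : (∑ k ∈ Finset.range (n+1+1), ((auxM K k).card : ℚ) * (auxA K (n+1-k)).card)
    = ((auxM K (n+1)).card : ℚ) ^ 2 := by exact_mod_cast aux_rec K (n+1)
  have h2 : (∑ k ∈ Finset.range (n+1), ((auxM K k).card : ℚ) * (auxA K (n-k)).card)
    = ((auxM K n).card : ℚ) ^ 2 := by exact_mod_cast aux_rec K n
  rw [Finset.sum_range_succ', Finset.sum_range_succ'] at h1
  rw [Finset.sum_range_succ'] at h2
  have h3 : (∑ k ∈ Finset.range n, ((auxM K (k+1+1)).card : ℚ) * (auxA K (n+1-(k+1+1))).card)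
      = Fintype.card K * ∑ k ∈ Finset.range n, ((auxM K (k+1)).card : ℚ) * (auxA K (n-(k+1))).card := by
    rw [Finset.mul_sum]
    refine Finset.sum_congr rfl fun k _ => ?_
    rw [auxM_succ', auxM_succ', show n+1-(k+1+1) = n-(k+1) by omega]
    ring
  rw [h3] at h1
  have hm1 := auxM_succ' K 0
  have hm0 : ((auxM K 0).card : ℚ) = 1 := by rw [auxM_zero]; simp
  simp only [zero_add, Nat.add_sub_cancel, Nat.sub_zero, pow_zero, mul_one] at h1 h2 hm1
  rw [hm0] at h1 h2
  rw [hm1] at h1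
  linear_combination h1 - Fintype.card K * h2

lemma auxA_closed (K : Type*) [Field K] [Fintype K] (n : ℕ) :
    ((auxA K (n+1)).card : ℚ) = (Fintype.card K : ℚ) * ((Fintype.card K : ℚ) - 1) ^ 3 *
      (((Fintype.card K : ℚ) ^ (2 * n) - 1) / ((Fintype.card K : ℚ) ^ 2 - 1))
        + ((Fintype.card K : ℚ) - 1) * ((Fintype.card K : ℚ) - 2) := by
  have hq : (1 : ℚ) < Fintype.card K := by exact_mod_cast Fintype.one_lt_card
  have hq' : (Fintype.card K : ℚ) ^ 2 - 1 ≠ 0 := by nlinarith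
  induction n with
  | zero =>
    rw [auxA_step, auxA_zero, auxM_succ', auxM_zero]
    simp
    ring
  | succ n ih =>
    rw [auxA_step, ih, auxM_succ', auxM_succ']
    field_simp
    ring

open Polynomial in
lemma aux_two (K : Type*) [Field K] [Fintype K] (n : ℕ) :
    2 * Nat.card {s : Finset (Polynomial K) //
        s.card = 2 ∧
        (∀ p ∈ s, p.Monic ∧ p.natDegree = n + 1 ∧ p.coeff 0 ≠ 0) ∧
        (∀ p ∈ s, ∀ g ∈ s, p ≠ g → IsCoprime p g)} = (auxA K (n+1)).card := by
  classical
  have hne : ∀ a b : K[X], (a, b) ∈ auxA K (n+1) → a ≠ b := by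
    rintro a b h rfl
    obtain ⟨⟨h1, -⟩, h2⟩ := mem_auxA.1 h
    have h3 := (mem_auxM.1 h1).2.1
    have h4 := natDegree_eq_zero_of_isUnit (isCoprime_self.1 h2)
    dsimp only at h3 h4
    omega
  set f : K[X] × K[X] → Finset K[X] := fun x => {x.1, x.2} with hf
  have hset : ∀ s : Finset K[X], (s.card = 2 ∧
        (∀ p ∈ s, p.Monic ∧ p.natDegree = n + 1 ∧ p.coeff 0 ≠ 0) ∧
        (∀ p ∈ s, ∀ g ∈ s, p ≠ g → IsCoprime p g)) ↔ s ∈ (auxA K (n+1)).image f := by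
    intro s
    rw [Finset.mem_image]
    constructor
    · rintro ⟨h1, h2, h3⟩
      obtain ⟨a, b, hab, rfl⟩ := Finset.card_eq_two.1 h1
      refine ⟨(a, b), mem_auxA.2 ⟨⟨mem_auxM.2 (h2 a (by simp)), mem_auxM.2 (h2 b (by simp))⟩,
        h3 a (by simp) b (by simp) hab⟩, rfl⟩
    · rintro ⟨⟨a, b⟩, h, rfl⟩
      have hab := hne a b h
      obtain ⟨⟨h1, h2⟩, h3⟩ := mem_auxA.1 h
      refine ⟨Finset.card_pair hab, ?_, ?_⟩
      · intro p hp
        simp only [hf, Finset.mem_insert, Finset.mem_singleton] at hp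
        rcases hp with rfl | rfl
        · exact mem_auxM.1 h1
        · exact mem_auxM.1 h2
      · intro p hp g hg hpg
        simp only [hf, Finset.mem_insert, Finset.mem_singleton] at hp hg
        rcases hp with rfl | rfl <;> rcases hg with rfl | rfl
        · exact absurd rfl hpg
        · exact h3
        · exact h3.symm
        · exact absurd rfl hpg
  rw [Nat.card_congr (Equiv.subtypeEquivRight hset), Nat.card_eq_fintype_card, Fintype.card_coe]
  rw [Finset.card_eq_sum_card_image f (auxA K (n+1)), mul_comm, Finset.sum_const_nat]
  intro s hs
  obtain ⟨⟨a, b⟩, h, rfl⟩ := Finset.mem_image.1 hs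
  have hab := hne a b h
  have hba : (b, a) ∈ auxA K (n+1) := by
    obtain ⟨⟨h1, h2⟩, h3⟩ := mem_auxA.1 h
    exact mem_auxA.2 ⟨⟨h2, h1⟩, h3.symm⟩
  have : (auxA K (n+1)).filter (fun x => f x = f (a, b)) = {(a, b), (b, a)} := by
    ext ⟨c, d⟩
    simp only [Finset.mem_filter, Finset.mem_insert, Finset.mem_singleton, Prod.mk.injEq]
    constructor
    · rintro ⟨h1, h2⟩
      have h2' : ({c, d} : Finset K[X]) = {a, b} := h2
      have hcd := hne c d h1
      have hc : c ∈ ({a, b} : Finset K[X]) := h2' ▸ by simp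
      have hd : d ∈ ({a, b} : Finset K[X]) := h2' ▸ by simp
      simp only [Finset.mem_insert, Finset.mem_singleton] at hc hd
      grind
    · rintro (⟨rfl, rfl⟩ | ⟨rfl, rfl⟩)
      · exact ⟨h, rfl⟩
      · exact ⟨hba, Finset.pair_comm _ _⟩
  rw [this]
  exact Finset.card_pair (by simp [hab])

/-- The number of unordered pairs of distinct coprime monic polynomials of degree `n`
with nonzero constant term over a finite field with `q` elements equals
`(1/2)·( q(q-1)³·(q^{2n-2} - 1)/(q² - 1) + (q-1)(q-2) )`.
Unordered pairs of distinct elements are modelled as `Finset`s of cardinality 2. -/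
theorem stmt6 {K : Type*} [Field K] [Fintype K] {n : ℕ} (hn : 1 ≤ n) (q : ℕ)
    (hq : Fintype.card K = q) :
    (Nat.card {s : Finset (Polynomial K) //
        s.card = 2 ∧
        (∀ p ∈ s, p.Monic ∧ p.natDegree = n ∧ p.coeff 0 ≠ 0) ∧
        (∀ p ∈ s, ∀ g ∈ s, p ≠ g → IsCoprime p g)} : ℚ) =
      (1 / 2) * ((q : ℚ) * ((q : ℚ) - 1) ^ 3 * (((q : ℚ) ^ (2 * n - 2) - 1) / ((q : ℚ) ^ 2 - 1))
        + ((q : ℚ) - 1) * ((q : ℚ) - 2)) := by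
  subst hq
  obtain ⟨m, rfl⟩ := Nat.exists_eq_add_of_le' hn
  rw [show 2 * (m + 1) - 2 = 2 * m by omega, ← auxA_closed, ← aux_two]
  push_cast
  ring
end

section
/- Let n ≥ 1. The number of unordered pairs {p, g} of distinct coprime monic polynomials over F_2, both of degree n and both with nonzero constant term, equals (4^{n-1} - 1)/3. -/
open Polynomial in
noncomputable def LL (m : ℕ) : Finset (Polynomial (ZMod 2)) :=
  (Finset.univ : Finset (Fin m → ZMod 2)).image
    (fun v => ((degreeLTEquiv (ZMod 2) m).symm v : (ZMod 2)[X]))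

open Polynomial in
theorem mem_LL (m : ℕ) (p : (ZMod 2)[X]) : p ∈ LL m ↔ p.degree < m := by
  unfold LL
  rw [Finset.mem_image, ← mem_degreeLT]
  constructor
  · rintro ⟨v, -, rfl⟩
    exact Subtype.property _
  · intro h
    exact ⟨degreeLTEquiv (ZMod 2) m ⟨p, h⟩, Finset.mem_univ _, by simp⟩

theorem card_LL (m : ℕ) : (LL m).card = 2 ^ m := by
  unfold LL
  rw [Finset.card_image_of_injective]
  · simp
  · exact Subtype.val_injective.comp (LinearEquiv.injective _)

open Polynomial in
noncomputable def MM : ℕ → Finset (Polynomial (ZMod 2))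
  | 0 => {1}
  | m + 1 => (LL m).image (fun q => X ^ (m + 1) + (X * q + 1))

theorem z2_ne {a : ZMod 2} (h : a ≠ 0) : a = 1 := by
  revert a; decide

open Polynomial in
theorem z2_monic {p : (ZMod 2)[X]} (h : p ≠ 0) : p.Monic :=
  z2_ne (leadingCoeff_ne_zero.mpr h)

open Polynomial in
theorem mem_MM (n : ℕ) (p : (ZMod 2)[X]) : p ∈ MM n ↔ p.natDegree = n ∧ p.coeff 0 ≠ 0 := by
  cases n with
  | zero =>
    simp only [MM, Finset.mem_singleton]
    constructor
    · rintro rfl; simp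
    · rintro ⟨h, h0⟩
      rw [eq_C_of_natDegree_eq_zero h, z2_ne h0, C_1]
  | succ m =>
    simp only [MM, Finset.mem_image, mem_LL]
    constructor
    · rintro ⟨q, hq, rfl⟩
      refine ⟨?_, by simp⟩
      apply natDegree_eq_of_degree_eq_some
      have h1 : (X * q + 1 : (ZMod 2)[X]).degree < ((m + 1 : ℕ) : WithBot ℕ) := by
        rw [degree_lt_iff_coeff_zero] at hq ⊢
        intro k hk
        obtain ⟨k, rfl⟩ : ∃ j, k = j + 1 := ⟨k - 1, by omega⟩
        rw [coeff_add, coeff_X_mul, hq k (by omega), coeff_one]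
        simp
      rw [degree_add_eq_left_of_degree_lt] <;> simp only [degree_X_pow]
      exact h1
    · rintro ⟨hd, h0⟩
      have hm : p.Monic := z2_monic (by rintro rfl; simp at h0)
      refine ⟨p.divX - X ^ m, ?_, ?_⟩
      · rw [degree_lt_iff_coeff_zero]
        intro k hk
        rw [coeff_sub, coeff_divX, coeff_X_pow]
        split_ifs with h
        · subst h
          have := hm.coeff_natDegree
          rw [hd] at this
          simp [this]
        · rw [coeff_eq_zero_of_natDegree_lt (by omega)]; simp
      · conv_rhs => rw [← X_mul_divX_add p, z2_ne h0, C_1]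
        ring

open Polynomial in
theorem card_MM (m : ℕ) : (MM (m + 1)).card = 2 ^ m := by
  simp only [MM]
  rw [Finset.card_image_of_injective, card_LL]
  intro a b h
  simpa using h

open Polynomial in
open Classical in
noncomputable def CP (n : ℕ) : Finset ((ZMod 2)[X] × (ZMod 2)[X]) :=
  (MM n ×ˢ MM n).filter (fun x => IsCoprime x.1 x.2)

open Polynomial in
theorem z2_assoc {p q : (ZMod 2)[X]} (h1 : p ∣ q) (h2 : q ∣ p) : p = q := by
  by_cases hp : p = 0
  · subst hp; exact (zero_dvd_iff.mp h1).symm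
  by_cases hq : q = 0
  · subst hq; exact (zero_dvd_iff.mp h2)
  exact eq_of_monic_of_associated (z2_monic hp) (z2_monic hq) (associated_of_dvd_dvd h1 h2)

open Polynomial in
theorem mul_mem_MM {a b : ℕ} {p q : (ZMod 2)[X]} (hp : p ∈ MM a) (hq : q ∈ MM b) :
    p * q ∈ MM (a + b) := by
  rw [mem_MM] at *
  have h1 : p ≠ 0 := by rintro rfl; simp at hp
  have h2 : q ≠ 0 := by rintro rfl; simp at hq
  rw [natDegree_mul h1 h2, mul_coeff_zero]
  exact ⟨by omega, mul_ne_zero hp.2 hq.2⟩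

open Polynomial in
theorem dvd_of_cop {h p g h' p' g' : (ZMod 2)[X]} (hc : IsCoprime p g)
    (h1 : h * p = h' * p') (h2 : h * g = h' * g') : h' ∣ h := by
  obtain ⟨a, b, hab⟩ := hc
  refine ⟨a * p' + b * g', ?_⟩
  linear_combination (-h) * hab + a * h1 + b * h2

open Polynomial in
theorem conv (n : ℕ) : (MM n).card * (MM n).card =
    ∑ d ∈ Finset.range (n + 1), (MM d).card * (CP (n - d)).card := by
  rw [← Finset.card_product]
  simp_rw [← Finset.card_product]
  rw [← Finset.card_sigma]
  symm
  refine Finset.card_bij (fun x _ => (x.2.1 * x.2.2.1, x.2.1 * x.2.2.2)) ?_ ?_ ?_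
  · rintro ⟨d, h, p, g⟩ hx
    simp only [Finset.mem_sigma, Finset.mem_range, Finset.mem_product, CP, Finset.mem_filter] at hx ⊢
    obtain ⟨hd, hh, ⟨hp, hg⟩, -⟩ := hx
    have e : d + (n - d) = n := by omega
    have := mul_mem_MM hh hp
    have := mul_mem_MM hh hg
    simp_all
  · rintro ⟨d, h, p, g⟩ hx ⟨d', h', p', g'⟩ hx' heq
    simp only [Finset.mem_sigma, Finset.mem_range, Finset.mem_product, CP, Finset.mem_filter,
      Prod.mk.injEq] at hx hx' heq
    obtain ⟨hd, hh, ⟨hp, hg⟩, hc⟩ := hx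
    obtain ⟨hd', hh', ⟨hp', hg'⟩, hc'⟩ := hx'
    have e : h = h' := z2_assoc (dvd_of_cop hc' heq.1.symm heq.2.symm) (dvd_of_cop hc heq.1 heq.2)
    subst e
    rw [mem_MM] at hh hh'
    have h0 : h ≠ 0 := by rintro rfl; simp at hh
    obtain rfl : d = d' := hh.1.symm.trans hh'.1
    rw [mul_right_inj' h0, mul_right_inj' h0] at heq
    rw [heq.1, heq.2]
  · rintro ⟨P, G⟩ hx
    simp only [Finset.mem_product, mem_MM] at hx
    obtain ⟨⟨hP, hP0⟩, hG, hG0⟩ := hx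
    have P0 : P ≠ 0 := by rintro rfl; simp at hP0
    have G0 : G ≠ 0 := by rintro rfl; simp at hG0
    obtain ⟨p, hp⟩ := EuclideanDomain.gcd_dvd_left P G
    obtain ⟨g, hg⟩ := EuclideanDomain.gcd_dvd_right P G
    have hbez := EuclideanDomain.gcd_eq_gcd_ab P G
    set h := EuclideanDomain.gcd P G with hh
    clear_value h
    generalize EuclideanDomain.gcdA P G = a at hbez
    generalize EuclideanDomain.gcdB P G = b at hbez
    clear hh
    subst hp
    have h0 : h ≠ 0 := left_ne_zero_of_mul P0
    have p0 : p ≠ 0 := right_ne_zero_of_mul P0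
    have hc : IsCoprime p g := by
      refine ⟨a, b, ?_⟩
      apply mul_left_cancel₀ h0
      linear_combination -hbez - b * hg
    subst hg
    have g0 : g ≠ 0 := right_ne_zero_of_mul G0
    rw [natDegree_mul h0 p0] at hP
    rw [natDegree_mul h0 g0] at hG
    rw [mul_coeff_zero] at hP0 hG0
    refine ⟨⟨h.natDegree, h, p, g⟩, ?_, rfl⟩
    simp only [Finset.mem_sigma, Finset.mem_range, Finset.mem_product, CP, Finset.mem_filter, mem_MM]
    exact ⟨by omega, ⟨trivial, left_ne_zero_of_mul hP0⟩, ⟨⟨by omega, right_ne_zero_of_mul hP0⟩,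
      by omega, right_ne_zero_of_mul hG0⟩, hc⟩

theorem card_CC0 : (CP 0).card = 1 := by
  have := conv 0
  simpa [MM] using this.symm

noncomputable def SS (n : ℕ) : ℕ := ∑ d ∈ Finset.range n, 2 ^ d * (CP (n - (d + 1))).card

theorem SS_succ (n : ℕ) : SS (n + 1) = (CP n).card + 2 * SS n := by
  unfold SS
  rw [Finset.sum_range_succ', Finset.mul_sum, add_comm]
  congr 1
  · simp
  · apply Finset.sum_congr rfl
    intro d _
    rw [Nat.add_sub_add_right]
    ring

theorem CC_SS (n : ℕ) : 4 ^ n = (CP (n + 1)).card + SS (n + 1) := by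
  have := conv (n + 1)
  rw [card_MM, Finset.sum_range_succ'] at this
  simp only [card_MM] at this
  unfold SS
  rw [add_comm, show 4 ^ n = 2 ^ n * 2 ^ n by rw [← mul_pow]; norm_num, this]
  simp [MM]

theorem SS_val (n : ℕ) : 3 * SS (n + 1) = 4 ^ n + 2 := by
  induction n with
  | zero => rw [SS_succ, card_CC0]; simp [SS]
  | succ k ih =>
    have := CC_SS k
    rw [SS_succ, pow_succ]
    omega

theorem CC_val (n : ℕ) : 3 * (CP (n + 1)).card + 2 = 2 * 4 ^ n := by
  have := CC_SS n
  have := SS_val n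
  omega

open Classical in
theorem final_count (n : ℕ) (hn : 1 ≤ n) : (CP n).card = 2 *
    (Nat.card {s : Finset (Polynomial (ZMod 2)) //
        s.card = 2 ∧
        (∀ p ∈ s, p.Monic ∧ p.natDegree = n ∧ p.coeff 0 ≠ 0) ∧
        (∀ p ∈ s, ∀ g ∈ s, p ≠ g → IsCoprime p g)}) := by
  have hne : ∀ p g, (p, g) ∈ CP n → p ≠ g := by
    rintro p _ h rfl
    simp only [CP, Finset.mem_filter, Finset.mem_product, mem_MM, isCoprime_self] at h
    have := Polynomial.natDegree_eq_zero_of_isUnit h.2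
    omega
  have hsym : ∀ p g, (p, g) ∈ CP n → (g, p) ∈ CP n := by
    intro p g h
    simp only [CP, Finset.mem_filter, Finset.mem_product] at h ⊢
    exact ⟨⟨h.1.2, h.1.1⟩, h.2.symm⟩
  let T : Finset (Finset (Polynomial (ZMod 2))) := (CP n).image (fun x => {x.1, x.2})
  have hT : ∀ s, s ∈ T ↔ (s.card = 2 ∧
        (∀ p ∈ s, p.Monic ∧ p.natDegree = n ∧ p.coeff 0 ≠ 0) ∧
        (∀ p ∈ s, ∀ g ∈ s, p ≠ g → IsCoprime p g)) := by
    intro s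
    simp only [T, Finset.mem_image]
    constructor
    · rintro ⟨⟨p, g⟩, h, rfl⟩
      have h1 := hne p g h
      simp only [CP, Finset.mem_filter, Finset.mem_product, mem_MM] at h
      obtain ⟨⟨hp, hg⟩, hc⟩ := h
      have hmon : ∀ q : Polynomial (ZMod 2), q.coeff 0 ≠ 0 → q.Monic := fun q hq =>
        z2_monic (by rintro rfl; simp at hq)
      refine ⟨Finset.card_pair h1, ?_, ?_⟩
      · intro q hq
        simp only [Finset.mem_insert, Finset.mem_singleton] at hq
        rcases hq with rfl | rfl
        · exact ⟨hmon _ hp.2, hp⟩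
        · exact ⟨hmon _ hg.2, hg⟩
      · intro q hq r hr hqr
        simp only [Finset.mem_insert, Finset.mem_singleton] at hq hr
        rcases hq with rfl | rfl <;> rcases hr with rfl | rfl
        · exact absurd rfl hqr
        · exact hc
        · exact hc.symm
        · exact absurd rfl hqr
    · rintro ⟨h2, hm, hc⟩
      obtain ⟨p, g, hpg, rfl⟩ := Finset.card_eq_two.mp h2
      refine ⟨(p, g), ?_, rfl⟩
      simp only [CP, Finset.mem_filter, Finset.mem_product, mem_MM]
      exact ⟨⟨(hm p (by simp)).2, (hm g (by simp)).2⟩, hc p (by simp) g (by simp) hpg⟩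
  rw [Nat.subtype_card T hT]
  rw [Finset.card_eq_sum_card_image (fun x => ({x.1, x.2} : Finset (Polynomial (ZMod 2)))) (CP n)]
  rw [Finset.sum_const_nat (m := 2), mul_comm]
  intro s hs
  obtain ⟨⟨p, g⟩, h, rfl⟩ := Finset.mem_image.mp hs
  have h1 := hne p g h
  rw [Finset.card_eq_two]
  refine ⟨(p, g), (g, p), fun e => h1 (Prod.mk.inj e).1, ?_⟩
  ext ⟨a, b⟩
  simp only [Finset.mem_filter, Finset.mem_insert, Finset.mem_singleton, Prod.mk.injEq]
  constructor
  · rintro ⟨-, e⟩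
    rw [← Finset.coe_inj] at e
    push_cast at e
    exact Set.pair_eq_pair_iff.mp e
  · rintro (⟨rfl, rfl⟩ | ⟨rfl, rfl⟩)
    · exact ⟨h, rfl⟩
    · exact ⟨hsym _ _ h, Finset.pair_comm _ _⟩

/-- Over `F_2`, the number of unordered pairs of distinct coprime monic polynomials of
degree `n` with nonzero constant term equals `(4^{n-1} - 1)/3`.
Unordered pairs of distinct elements are modelled as `Finset`s of cardinality 2. -/
theorem stmt7 {n : ℕ} (hn : 1 ≤ n) :
    (Nat.card {s : Finset (Polynomial (ZMod 2)) //
        s.card = 2 ∧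
        (∀ p ∈ s, p.Monic ∧ p.natDegree = n ∧ p.coeff 0 ≠ 0) ∧
        (∀ p ∈ s, ∀ g ∈ s, p ≠ g → IsCoprime p g)} : ℚ) =
      ((4 : ℚ) ^ (n - 1) - 1) / 3 := by
  have h := final_count n hn
  obtain ⟨m, rfl⟩ : ∃ m, n = m + 1 := ⟨n - 1, by omega⟩
  have h2 := CC_val m
  rw [h] at h2
  have h3 := congrArg (Nat.cast : ℕ → ℚ) h2
  push_cast at h3
  rw [Nat.add_sub_cancel]
  linarith
end

section
/- Let q be a prime power and n ≥ 1. For k ≥ 1 let I_k denote the number of monic irreducible polynomials of degree k over F_q with nonzero constant term (i.e., monic irreducibles of degree k different from X). Then the maximum cardinality of a set of pairwise coprime monic polynomials over F_q, all of degree n and all with nonzero constant term, equals N_n = I_n + Σ_{k=1}^{⌊n/2⌋} I_k. Equivalently, N_n is the maximum number of mutually orthogonal Latin squares generated by linear bipermutive cellular automata of diameter d = n+1 over F_q. -/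
/-- `numIrred K k` is the number `I_k` of monic irreducible polynomials of degree `k`
over `K` with nonzero constant term. -/
noncomputable def numIrred (K : Type*) [Field K] [Fintype K] (k : ℕ) : ℕ :=
  Nat.card {p : Polynomial K // p.Monic ∧ Irreducible p ∧ p.natDegree = k ∧ p.coeff 0 ≠ 0}

open Polynomial UniqueFactorizationMonoid

section aux
variable (K : Type*) [Field K] [Fintype K]

open Classical in
noncomputable def facs (d : ℕ) : Finset K[X] :=
  (normalizedFactors (X ^ (Nat.card K) ^ d - X : K[X])).toFinset

open Classical in
noncomputable def irrs (d : ℕ) : Finset K[X] :=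
  (facs K d).filter (fun p => p.natDegree = d)

lemma F_ne_zero {d : ℕ} (hd : d ≠ 0) : (X ^ (Nat.card K) ^ d - X : K[X]) ≠ 0 :=
  FiniteField.X_pow_card_pow_sub_X_ne_zero _ hd Finite.one_lt_card

lemma F_sep {d : ℕ} (hd : d ≠ 0) : (X ^ (Nat.card K) ^ d - X : K[X]).Separable := by
  obtain ⟨p, hp⟩ := CharP.exists K
  apply galois_poly_separable p
  rw [← CharP.cast_eq_zero_iff K p, Nat.card_eq_fintype_card]
  push_cast
  rw [FiniteField.cast_card_eq_zero, zero_pow hd]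

lemma mem_facs {d : ℕ} (hd : d ≠ 0) (p : K[X]) :
    p ∈ facs K d ↔ p.Monic ∧ Irreducible p ∧ p.natDegree ∣ d := by
  classical
  rw [facs, Multiset.mem_toFinset, mem_normalizedFactors_iff' (F_ne_zero K hd)]
  constructor
  · rintro ⟨h1, h2, h3⟩
    refine ⟨?_, h1, h1.natDegree_dvd_of_dvd_X_pow_card_pow_sub_X h3⟩
    rw [← h2]; exact monic_normalize h1.ne_zero
  · rintro ⟨h1, h2, h3⟩
    exact ⟨h2, h1.normalize_eq_self, (h2.natDegree_dvd_iff_dvd_X_pow_card_pow_sub_X).1 h3⟩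

lemma mem_irrs {d : ℕ} (hd : d ≠ 0) (p : K[X]) :
    p ∈ irrs K d ↔ p.Monic ∧ Irreducible p ∧ p.natDegree = d := by
  classical
  rw [irrs, Finset.mem_filter, mem_facs K hd]
  constructor
  · rintro ⟨⟨h1, h2, h3⟩, h4⟩; exact ⟨h1, h2, h4⟩
  · rintro ⟨h1, h2, h3⟩; exact ⟨⟨h1, h2, h3 ▸ dvd_rfl⟩, h3⟩

lemma sum_facs {d : ℕ} (hd : d ≠ 0) : ∑ p ∈ facs K d, p.natDegree = Nat.card K ^ d := by
  classical
  have hF := F_ne_zero K hd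
  have h1 : Associated (normalizedFactors (X ^ (Nat.card K) ^ d - X : K[X])).prod _ :=
    prod_normalizedFactors hF
  have hnd : (normalizedFactors (X ^ (Nat.card K) ^ d - X : K[X])).Nodup :=
    (squarefree_iff_nodup_normalizedFactors hF).1 (F_sep K hd).squarefree
  have h2 : (∏ p ∈ facs K d, p) = (normalizedFactors (X ^ (Nat.card K) ^ d - X : K[X])).prod := by
    rw [facs, Finset.prod, Multiset.toFinset_val, hnd.dedup, Multiset.map_id']
  have h3 := natDegree_eq_of_degree_eq (degree_eq_degree_of_associated h1)
  rw [← h2, FiniteField.X_pow_card_pow_sub_X_natDegree_eq _ hd Finite.one_lt_card,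
    natDegree_prod_of_monic] at h3
  · exact h3
  · intro p hp; exact ((mem_facs K hd p).1 hp).1

lemma sum_irrs {n : ℕ} (hn : n ≠ 0) : ∑ d ∈ n.divisors, d * (irrs K d).card = Nat.card K ^ n := by
  classical
  rw [← sum_facs K hn, ← Finset.sum_fiberwise_of_maps_to (s := facs K n) (t := n.divisors)
    (g := fun p => p.natDegree)]
  · refine Finset.sum_congr rfl fun d hd => ?_
    have hd' := Nat.dvd_of_mem_divisors hd
    have hd0 : d ≠ 0 := fun h => hn (by subst h; exact Nat.eq_zero_of_zero_dvd hd')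
    have : irrs K d = (facs K n).filter (fun p => p.natDegree = d) := by
      ext p
      rw [mem_irrs K hd0, Finset.mem_filter, mem_facs K hn]
      constructor
      · rintro ⟨h1, h2, h3⟩; exact ⟨⟨h1, h2, h3 ▸ hd'⟩, h3⟩
      · rintro ⟨⟨h1, h2, h3⟩, h4⟩; exact ⟨h1, h2, h4⟩
    rw [← this, Finset.sum_const_nat (m := d), mul_comm]
    intro p hp; exact ((mem_irrs K hd0 p).1 hp).2.2
  · intro p hp
    exact Nat.mem_divisors.2 ⟨((mem_facs K hn p).1 hp).2.2, hn⟩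

lemma card_one : (irrs K 1).card = Nat.card K := by
  simpa using sum_irrs K one_ne_zero

lemma card_upper {k : ℕ} (hk : k ≠ 0) : k * (irrs K k).card ≤ Nat.card K ^ k := by
  rw [← sum_irrs K hk]
  exact Finset.single_le_sum (f := fun d => d * (irrs K d).card) (fun _ _ => Nat.zero_le _)
    (Nat.mem_divisors_self k hk)

lemma card_upper' {k : ℕ} (hk : 2 ≤ k) : Nat.card K + k * (irrs K k).card ≤ Nat.card K ^ k := by
  rw [← sum_irrs K (n := k) (by omega)]
  have : ∑ d ∈ ({1, k} : Finset ℕ), d * (irrs K d).card ≤ ∑ d ∈ k.divisors, d * (irrs K d).card := by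
    apply Finset.sum_le_sum_of_subset
    intro d hd
    simp only [Finset.mem_insert, Finset.mem_singleton] at hd
    rcases hd with rfl | rfl <;> simp <;> omega
  rwa [Finset.sum_pair (by omega), card_one, one_mul] at this

lemma geom (q : ℕ) (hq : 2 ≤ q) (h : ℕ) : (∑ d ∈ Finset.Icc 1 (h+1), q ^ d) + q ≤ 2 * q ^ (h+1) := by
  induction h with
  | zero => simp; omega
  | succ h ih =>
    rw [Finset.sum_Icc_succ_top (by omega)]
    have : 2 * q ^ (h+1) ≤ q ^ (h+1+1) := by
      rw [pow_succ q (h+1), mul_comm]; exact Nat.mul_le_mul_left _ hq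
    omega

lemma card_lower {k : ℕ} (hk : k ≠ 0) :
    Nat.card K ^ k ≤ k * (irrs K k).card + ∑ d ∈ Finset.Icc 1 (k/2), Nat.card K ^ d := by
  rw [← sum_irrs K hk, ← Nat.cons_self_properDivisors hk, Finset.sum_cons]
  gcongr
  calc _ ≤ ∑ d ∈ k.properDivisors, Nat.card K ^ d := by
        refine Finset.sum_le_sum fun d hd => card_upper K ?_
        exact (Nat.pos_of_mem_properDivisors hd).ne'
    _ ≤ _ := by
        apply Finset.sum_le_sum_of_subset
        intro d hd
        have h0 := Nat.pos_of_mem_properDivisors hd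
        obtain ⟨⟨c, hc⟩, h2⟩ := Nat.mem_properDivisors.1 hd
        rw [Finset.mem_Icc]
        refine ⟨h0, ?_⟩
        rw [Nat.le_div_iff_mul_le (by norm_num)]
        have : 2 ≤ c := by
          by_contra hh
          interval_cases c <;> omega
        nlinarith

open Classical in
noncomputable def T (d : ℕ) : Finset K[X] := (irrs K d).filter (fun p => p.coeff 0 ≠ 0)

lemma mem_T {d : ℕ} (hd : d ≠ 0) (p : K[X]) :
    p ∈ T K d ↔ p.Monic ∧ Irreducible p ∧ p.natDegree = d ∧ p.coeff 0 ≠ 0 := by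
  classical
  rw [T, Finset.mem_filter, mem_irrs K hd]; tauto

lemma numIrred_eq {d : ℕ} (hd : d ≠ 0) : numIrred K d = (T K d).card := by
  rw [numIrred]
  exact Nat.subtype_card _ (mem_T K hd)

lemma T_eq {d : ℕ} (hd : 2 ≤ d) : T K d = irrs K d := by
  classical
  rw [T, Finset.filter_eq_self]
  intro p hp h0
  obtain ⟨h1, h2, h3⟩ := (mem_irrs K (by omega) p).1 hp
  have := (irreducible_X (R := K)).associated_of_dvd h2 (X_dvd_iff.2 h0)
  have := natDegree_eq_of_degree_eq (degree_eq_degree_of_associated this)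
  rw [natDegree_X] at this
  omega

lemma T_one : (T K 1).card + 1 = Nat.card K := by
  classical
  have hX : X ∈ irrs K 1 := (mem_irrs K one_ne_zero X).2 ⟨monic_X, irreducible_X, natDegree_X⟩
  have : T K 1 = (irrs K 1).erase X := by
    ext p
    rw [mem_T K one_ne_zero, Finset.mem_erase, mem_irrs K one_ne_zero]
    constructor
    · rintro ⟨h1, h2, h3, h4⟩
      exact ⟨fun h => h4 (by simp [h]), h1, h2, h3⟩
    · rintro ⟨h1, h2, h3, h4⟩
      refine ⟨h2, h3, h4, fun h0 => h1 ?_⟩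
      exact (eq_of_monic_of_associated monic_X h2
        ((irreducible_X (R := K)).associated_of_dvd h3 (X_dvd_iff.2 h0))).symm
  rw [this, Finset.card_erase_add_one hX, card_one]

lemma arith (q k : ℕ) (hq : 2 ≤ q) (hk : 2 ≤ k) :
    2 * k * q ^ ((k+1)/2) ≤ (k - 1) * q ^ k + (2 * k + 1) * q := by
  obtain rfl | rfl | h4 : k = 2 ∨ k = 3 ∨ 4 ≤ k := by omega
  · norm_num; nlinarith
  · norm_num
    zify
    nlinarith [sq_nonneg ((2:ℤ) * q - 3)]
  · have : 4 * q ^ ((k+1)/2) ≤ q ^ k := by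
      calc 4 * q ^ ((k+1)/2) ≤ q^2 * q ^ ((k+1)/2) := by gcongr; nlinarith
        _ = q ^ (2 + (k+1)/2) := (pow_add _ _ _).symm
        _ ≤ q ^ k := Nat.pow_le_pow_right (by omega) (by omega)
    calc 2 * k * q ^ ((k+1)/2) ≤ (k-1) * 4 * q ^ ((k+1)/2) :=
        Nat.mul_le_mul_right _ (by omega)
      _ ≤ (k-1) * q ^ k := by rw [mul_assoc]; gcongr
      _ ≤ _ := Nat.le_add_right _ _

lemma T_succ {k : ℕ} (hk : 1 ≤ k) : (T K k).card ≤ (T K (k+1)).card := by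
  have hq : 2 ≤ Nat.card K := Finite.one_lt_card
  obtain rfl | hk2 : k = 1 ∨ 2 ≤ k := by omega
  · rw [T_eq K (d := 1+1) (by norm_num)]
    have h1 := T_one K
    have h2 := sum_irrs K (n := 2) (by norm_num)
    rw [Nat.Prime.sum_divisors Nat.prime_two, card_one] at h2
    norm_num
    generalize Nat.card K = q at *
    generalize (T K 1).card = a at *
    subst h1
    nlinarith
  · rw [T_eq K hk2, T_eq K (by omega)]
    have h1 := card_upper' K hk2
    have h2 := card_lower K (k := k+1) (by omega)
    have h3 := arith _ k hq hk2
    have h4 := geom _ hq ((k+1)/2 - 1)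
    rw [Nat.sub_add_cancel (by omega)] at h4
    generalize Nat.card K = q at *
    generalize (irrs K k).card = a at *
    generalize (irrs K (k+1)).card = b at *
    generalize ∑ d ∈ Finset.Icc 1 ((k+1)/2), q ^ d = s at *
    generalize q ^ ((k+1)/2) = r at *
    rw [pow_succ] at h2
    generalize q ^ k = Q at *
    obtain ⟨k, rfl⟩ : ∃ j, k = j + 1 := ⟨k-1, by omega⟩
    simp only [Nat.add_sub_cancel] at h3
    have h5 : Q * 2 ≤ Q * q := Nat.mul_le_mul_left _ hq
    have h6 : 2 * Q + q ≤ (k+1+1) * b + 2 * r := by omega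
    have h7 : (k+1) * (2 * Q + q) ≤ (k+1) * ((k+1+1) * b + 2 * r) := Nat.mul_le_mul_left _ h6
    have h8 : (k+2) * (q + (k+1) * a) ≤ (k+2) * Q := Nat.mul_le_mul_left _ h1
    have : (k+1)*(k+2) * a ≤ (k+1)*(k+2) * b := by nlinarith
    exact Nat.le_of_mul_le_mul_left this (by positivity)

lemma T_mono {k m : ℕ} (hk : 1 ≤ k) (hkm : k ≤ m) : (T K k).card ≤ (T K m).card := by
  induction m, hkm using Nat.le_induction with
  | base => rfl
  | succ m hm ih => exact ih.trans (T_succ K (by omega))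

open Classical in
noncomputable def U (n : ℕ) : Finset K[X] := T K n ∪ (Finset.Icc 1 (n/2)).biUnion (T K)

lemma mem_U {n : ℕ} (hn : 1 ≤ n) (p : K[X]) : p ∈ U K n ↔
    p.Monic ∧ Irreducible p ∧ (p.natDegree = n ∨ 2 * p.natDegree ≤ n) ∧ p.coeff 0 ≠ 0 := by
  classical
  rw [U, Finset.mem_union, Finset.mem_biUnion, mem_T K (by omega)]
  constructor
  · rintro (⟨h1, h2, h3, h4⟩ | ⟨d, hd, h⟩)
    · exact ⟨h1, h2, Or.inl h3, h4⟩
    · rw [Finset.mem_Icc] at hd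
      obtain ⟨h1, h2, h3, h4⟩ := (mem_T K (by omega) p).1 h
      exact ⟨h1, h2, Or.inr (by omega), h4⟩
  · rintro ⟨h1, h2, h3 | h3, h4⟩
    · exact Or.inl ⟨h1, h2, h3, h4⟩
    · have := h2.natDegree_pos
      exact Or.inr ⟨p.natDegree, Finset.mem_Icc.2 ⟨this, by omega⟩,
        (mem_T K this.ne' p).2 ⟨h1, h2, rfl, h4⟩⟩

lemma card_U {n : ℕ} (hn : 1 ≤ n) :
    (U K n).card = numIrred K n + ∑ k ∈ Finset.Icc 1 (n / 2), numIrred K k := by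
  classical
  rw [U, Finset.card_union_of_disjoint, Finset.card_biUnion, numIrred_eq K (by omega)]
  · congr 1
    refine Finset.sum_congr rfl fun d hd => ?_
    rw [Finset.mem_Icc] at hd
    rw [numIrred_eq K (by omega)]
  · intro a ha b hb hab
    rw [Finset.mem_coe, Finset.mem_Icc] at ha hb
    change Disjoint (T K a) (T K b)
    rw [Finset.disjoint_left]
    intro p hpa hpb
    rw [mem_T K (by omega)] at hpa hpb
    exact hab (hpa.2.2.1.symm.trans hpb.2.2.1)
  · rw [Finset.disjoint_left]
    intro p hp hp2
    obtain ⟨d, hd, h⟩ := Finset.mem_biUnion.1 hp2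
    rw [Finset.mem_Icc] at hd
    rw [mem_T K (by omega)] at hp h
    have := hp.2.2.1
    have := h.2.2.1
    omega

lemma exists_factor {n : ℕ} (hn : 1 ≤ n) (p : K[X]) (h1 : p.Monic) (h2 : p.natDegree = n)
    (h3 : p.coeff 0 ≠ 0) : ∃ f ∈ U K n, f ∣ p := by
  by_cases hp : Irreducible p
  · exact ⟨p, (mem_U K hn p).2 ⟨h1, hp, Or.inl h2, h3⟩, dvd_rfl⟩
  · have hp1 : p ≠ 1 := by rintro rfl; simp at h2; omega
    rw [h1.irreducible_iff_natDegree] at hp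
    push Not at hp
    obtain ⟨f, g, hf, hg, hfg, h0⟩ := hp hp1
    have key : ∀ f g : K[X], f.Monic → g.Monic → f * g = p → f.natDegree ≠ 0 →
        f.natDegree ≤ g.natDegree → ∃ f ∈ U K n, f ∣ p := by
      intro f g hf hg hfg h0 hle
      obtain ⟨r, hr, hri, hrf⟩ := exists_monic_irreducible_factor f
        (fun hu => h0 (natDegree_eq_zero_of_isUnit hu))
      have hrp : r ∣ p := hrf.trans ⟨g, hfg.symm⟩
      refine ⟨r, (mem_U K hn r).2 ⟨hr, hri, Or.inr ?_, ?_⟩, hrp⟩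
      · have := natDegree_le_of_dvd hrf hf.ne_zero
        have := hf.natDegree_mul hg
        rw [hfg] at this
        omega
      · intro h
        exact h3 (X_dvd_iff.1 ((X_dvd_iff.2 h).trans hrp))
    rcases le_total f.natDegree g.natDegree with h | h
    · exact key f g hf hg hfg h0.1 h
    · exact key g f hg hf (by rw [mul_comm, hfg]) h0.2 h

lemma coprime_of_ne {p q : K[X]} (hp : p.Monic) (hq : q.Monic) (hpi : Irreducible p)
    (hqi : Irreducible q) (h : p ≠ q) : IsCoprime p q := by
  rw [hpi.coprime_iff_not_dvd]
  exact fun hd => h (eq_of_monic_of_associated hp hq (hpi.associated_of_dvd hqi hd))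

lemma exists_emb (k m : ℕ) : ∃ e : K[X] → K[X], 1 ≤ k → k ≤ m →
    (∀ p ∈ T K k, e p ∈ T K m) ∧ Set.InjOn e (T K k) := by
  by_cases h : 1 ≤ k ∧ k ≤ m
  · classical
    obtain ⟨e⟩ : Nonempty (T K k ↪ T K m) := Function.Embedding.nonempty_of_card_le (by
      rw [Fintype.card_coe, Fintype.card_coe]; exact T_mono K h.1 h.2)
    refine ⟨fun p => if hp : p ∈ T K k then (e ⟨p, hp⟩ : K[X]) else 0, fun _ _ => ⟨?_, ?_⟩⟩
    · intro p hp
      simp only [dif_pos hp]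
      exact (e ⟨p, hp⟩).2
    · intro p hp r hr hh
      rw [Finset.mem_coe] at hp hr
      simp only [dif_pos hp, dif_pos hr] at hh
      exact congrArg Subtype.val (e.injective (Subtype.ext hh))
  · exact ⟨id, fun a b => absurd ⟨a, b⟩ h⟩

lemma exists_partner {n : ℕ} (hn : 1 ≤ n) : ∃ φ : K[X] → K[X],
    (∀ p ∈ U K n, (φ p).Monic ∧ (φ p).natDegree + p.natDegree = n ∧ (φ p).coeff 0 ≠ 0) ∧
    (∀ p ∈ U K n, ∀ r ∈ U K n, p ≠ r → IsCoprime p (φ r) ∧ IsCoprime (φ p) (φ r)) := by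
  classical
  choose e he using fun k => exists_emb K k (n - k)
  let φ : K[X] → K[X] := fun p => if p.natDegree = n then 1 else
    if 2 * p.natDegree = n then p else e p.natDegree p
  have hφ : ∀ p ∈ U K n, (p.natDegree = n ∧ φ p = 1) ∨ (2 * p.natDegree = n ∧ φ p = p) ∨
      (2 * p.natDegree < n ∧ 1 ≤ p.natDegree ∧ φ p = e p.natDegree p ∧ p ∈ T K p.natDegree ∧
        φ p ∈ T K (n - p.natDegree)) := by
    intro p hp
    obtain ⟨h1, h2, h3, h4⟩ := (mem_U K hn p).1 hp
    have h0 := h2.natDegree_pos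
    by_cases ha : p.natDegree = n
    · left; exact ⟨ha, if_pos ha⟩
    · by_cases hb : 2 * p.natDegree = n
      · right; left; exact ⟨hb, by simp only [φ, if_neg ha, if_pos hb]⟩
      · right; right
        have hpe : φ p = e p.natDegree p := by simp only [φ, if_neg ha, if_neg hb]
        have hpT : p ∈ T K p.natDegree := (mem_T K h0.ne' p).2 ⟨h1, h2, rfl, h4⟩
        refine ⟨by omega, h0, hpe, hpT, ?_⟩
        rw [hpe]
        exact (he p.natDegree h0 (by omega)).1 p hpT
  have hφ2 : ∀ p ∈ U K n, φ p = 1 ∨ ((φ p).Monic ∧ Irreducible (φ p)) := by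
    intro p hp
    obtain ⟨h1, h2, h3, h4⟩ := (mem_U K hn p).1 hp
    rcases hφ p hp with ⟨_, h⟩ | ⟨_, h⟩ | ⟨h5, h6, h7, h8, h9⟩
    · exact Or.inl h
    · rw [h]; exact Or.inr ⟨h1, h2⟩
    · rw [mem_T K (by omega)] at h9
      exact Or.inr ⟨h9.1, h9.2.1⟩
  refine ⟨φ, ?_, ?_⟩
  · intro p hp
    obtain ⟨h1, h2, h3, h4⟩ := (mem_U K hn p).1 hp
    rcases hφ p hp with ⟨h5, h⟩ | ⟨h5, h⟩ | ⟨h5, h6, h7, h8, h9⟩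
    · rw [h]; exact ⟨monic_one, by simpa using h5, by simp⟩
    · rw [h]; exact ⟨h1, by omega, h4⟩
    · rw [mem_T K (by omega)] at h9
      exact ⟨h9.1, by omega, h9.2.2.2⟩
  · intro p hp r hr hpr
    obtain ⟨h1, h2, h3, h4⟩ := (mem_U K hn p).1 hp
    obtain ⟨k1, k2, k3, k4⟩ := (mem_U K hn r).1 hr
    constructor
    · rcases hφ2 r hr with h | ⟨hm, hi⟩
      · rw [h]; exact isCoprime_one_right
      · refine coprime_of_ne K h1 hm h2 hi ?_
        rcases hφ r hr with ⟨h5, h⟩ | ⟨h5, h⟩ | ⟨h5, h6, h7, h8, h9⟩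
        · rw [h] at hi; exact absurd hi not_irreducible_one
        · rw [h]; exact hpr
        · rw [mem_T K (by omega)] at h9
          intro hh
          rw [← hh] at h9
          omega
    · rcases hφ2 r hr with h | ⟨hm, hi⟩
      · rw [h]; exact isCoprime_one_right
      rcases hφ2 p hp with h | ⟨hm', hi'⟩
      · rw [h]; exact isCoprime_one_left
      refine coprime_of_ne K hm' hm hi' hi ?_
      rcases hφ p hp with ⟨_, h⟩ | ⟨a5, a⟩ | ⟨a5, a6, a7, a8, a9⟩
      · rw [h] at hi'; exact absurd hi' not_irreducible_one
      · rcases hφ r hr with ⟨_, h⟩ | ⟨b5, b⟩ | ⟨b5, b6, b7, b8, b9⟩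
        · rw [h] at hi; exact absurd hi not_irreducible_one
        · rw [a, b]; exact hpr
        · rw [mem_T K (by omega)] at b9
          intro hh
          rw [← hh, a] at b9
          omega
      · rw [mem_T K (by omega)] at a9
        rcases hφ r hr with ⟨_, h⟩ | ⟨b5, b⟩ | ⟨b5, b6, b7, b8, b9⟩
        · rw [h] at hi; exact absurd hi not_irreducible_one
        · intro hh
          rw [hh, b] at a9
          omega
        · rw [mem_T K (by omega)] at b9
          intro hh
          have hdeg : r.natDegree = p.natDegree := by
            have := a9.2.2.1
            have := b9.2.2.1
            rw [hh] at *
            omega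
          rw [a7, b7, hdeg] at hh
          rw [hdeg] at b8
          exact hpr ((he p.natDegree a6 (by omega)).2 a8 b8 hh)

end aux

/-- The maximum cardinality of a set of pairwise coprime monic polynomials of degree `n`
with nonzero constant term over a finite field equals `N_n = I_n + Σ_{k=1}^{⌊n/2⌋} I_k`. -/
theorem stmt8 {K : Type*} [Field K] [Fintype K] {n : ℕ} (hn : 1 ≤ n) :
    IsGreatest {m : ℕ | ∃ S : Finset (Polynomial K),
        S.card = m ∧
        (∀ p ∈ S, p.Monic ∧ p.natDegree = n ∧ p.coeff 0 ≠ 0) ∧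
        (∀ p ∈ S, ∀ g ∈ S, p ≠ g → IsCoprime p g)}
      (numIrred K n + ∑ k ∈ Finset.Icc 1 (n / 2), numIrred K k) := by
  classical
  rw [← card_U K hn]
  constructor
  · obtain ⟨φ, hφ, hc⟩ := exists_partner K hn
    have cop : ∀ p ∈ U K n, ∀ r ∈ U K n, p ≠ r → IsCoprime (p * φ p) (r * φ r) := by
      intro p hp r hr hpr
      obtain ⟨h1, h2, h3, h4⟩ := (mem_U K hn p).1 hp
      obtain ⟨k1, k2, k3, k4⟩ := (mem_U K hn r).1 hr
      exact IsCoprime.mul_left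
        (IsCoprime.mul_right (coprime_of_ne K h1 k1 h2 k2 hpr) (hc p hp r hr hpr).1)
        (IsCoprime.mul_right (hc r hr p hp hpr.symm).1.symm (hc p hp r hr hpr).2)
    have deg : ∀ p ∈ U K n, (p * φ p).natDegree = n := by
      intro p hp
      obtain ⟨h1, h2, h3⟩ := hφ p hp
      rw [((mem_U K hn p).1 hp).1.natDegree_mul h1]; omega
    refine ⟨(U K n).image (fun p => p * φ p), ?_, ?_, ?_⟩
    · apply Finset.card_image_of_injOn
      intro p hp r hr h
      by_contra hpr
      have h1 := cop p hp r hr hpr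
      simp only at h
      rw [← h, isCoprime_self] at h1
      have := natDegree_eq_zero_of_isUnit h1
      rw [deg p hp] at this
      omega
    · intro f hf
      obtain ⟨p, hp, rfl⟩ := Finset.mem_image.1 hf
      obtain ⟨h1, h2, h3⟩ := hφ p hp
      have hU := (mem_U K hn p).1 hp
      refine ⟨hU.1.mul h1, deg p hp, ?_⟩
      rw [mul_coeff_zero]
      exact mul_ne_zero hU.2.2.2 h3
    · intro f hf g hg hfg
      obtain ⟨p, hp, rfl⟩ := Finset.mem_image.1 hf
      obtain ⟨r, hr, rfl⟩ := Finset.mem_image.1 hg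
      exact cop p hp r hr (fun h => hfg (by rw [h]))
  · rintro m ⟨S, rfl, hS, hc⟩
    have : ∀ p : K[X], ∃ f, p ∈ S → f ∈ U K n ∧ f ∣ p := by
      intro p
      by_cases hp : p ∈ S
      · obtain ⟨f, h1, h2⟩ := exists_factor K hn p (hS p hp).1 (hS p hp).2.1 (hS p hp).2.2
        exact ⟨f, fun _ => ⟨h1, h2⟩⟩
      · exact ⟨0, fun h => absurd h hp⟩
    choose f hf using this
    refine Finset.card_le_card_of_injOn f (fun p hp => (hf p hp).1) ?_
    intro p hp r hr h
    by_contra hpr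
    have h1 := (hc p hp r hr hpr).isUnit_of_dvd' (hf p hp).2 (h ▸ (hf r hr).2)
    exact ((mem_U K hn _).1 (hf p hp).1).2.1.not_isUnit h1
end

section
/- Let d ≥ 2 and let f, g : F_2^d → F_2 be bipermutive local rules inducing the no-boundary cellular automata F, G : F_2^{2(d-1)} → F_2^{d-1}. If the Cayley tables C_F and C_G (which are Latin squares of order 2^{d-1}) are orthogonal, then f and g are pairwise balanced, i.e., the map x ↦ (f(x), g(x)) from F_2^d to F_2^2 takes each of the four values (0,0), (0,1), (1,0), (1,1) exactly 2^{d-2} times. -/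
theorem window_eq {k : ℕ} (f : (Fin (k + 2) → ZMod 2) → ZMod 2)
    (u v : Fin (k + 1) → ZMod 2) :
    cayley (k + 2) f u v (0 : Fin (k + 1)) =
      f (Fin.snoc (α := fun _ => ZMod 2) u (v 0)) := by
  unfold cayley caF
  congr 1
  funext j
  refine Fin.lastCases ?_ (fun j => ?_) j
  · simp [concat]
  · have := j.isLt
    rw [Fin.snoc_castSucc]
    simp [concat]
    intro h
    omega

def splitEquiv (k : ℕ) (f g : (Fin (k + 2) → ZMod 2) → ZMod 2) (b₁ b₂ : ZMod 2) :
    {p : (Fin (k + 1) → ZMod 2) × (Fin (k + 1) → ZMod 2) //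
      f (Fin.snoc (α := fun _ => ZMod 2) p.1 (p.2 0)) = b₁ ∧
      g (Fin.snoc (α := fun _ => ZMod 2) p.1 (p.2 0)) = b₂} ≃
    {x : Fin (k + 2) → ZMod 2 // f x = b₁ ∧ g x = b₂} × (Fin k → ZMod 2) where
  toFun p := (⟨Fin.snoc (α := fun _ => ZMod 2) p.1.1 (p.1.2 0), p.2⟩, Fin.tail p.1.2)
  invFun q := ⟨(Fin.init q.1.1, Fin.cons (q.1.1 (Fin.last _)) q.2), by
    simpa using q.1.2⟩
  left_inv p := by
    apply Subtype.ext
    simp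
  right_inv q := by
    apply Prod.ext
    · apply Subtype.ext
      simp
    · simp

def fixEquiv (k : ℕ) (b₁ b₂ : ZMod 2) :
    {q : (Fin (k + 1) → ZMod 2) × (Fin (k + 1) → ZMod 2) // q.1 0 = b₁ ∧ q.2 0 = b₂} ≃
    (Fin k → ZMod 2) × (Fin k → ZMod 2) where
  toFun q := (Fin.tail q.1.1, Fin.tail q.1.2)
  invFun r := ⟨(Fin.cons b₁ r.1, Fin.cons b₂ r.2), by simp⟩
  left_inv := by
    rintro ⟨⟨u, v⟩, rfl, rfl⟩
    simp
  right_inv r := by simp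

/-- If the Latin squares of two bipermutive CA over `F_2` are orthogonal, then the local
rules are pairwise balanced: each value of `(f(x), g(x))` is attained `2^{d-2}` times. -/
theorem stmt9 {d : ℕ} (hd : 2 ≤ d) (f g : (Fin d → ZMod 2) → ZMod 2)
    (hf : Bipermutive hd f) (hg : Bipermutive hd g)
    (horth : Orthogonal d f g) :
    ∀ b₁ b₂ : ZMod 2,
      Nat.card {x : Fin d → ZMod 2 // f x = b₁ ∧ g x = b₂} = 2 ^ (d - 2) := by
  intro b₁ b₂
  obtain ⟨k, rfl⟩ : ∃ k, d = k + 2 := ⟨d - 2, by omega⟩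
  have e : {p : (Fin (k + 1) → ZMod 2) × (Fin (k + 1) → ZMod 2) //
      f (Fin.snoc (α := fun _ => ZMod 2) p.1 (p.2 0)) = b₁ ∧
      g (Fin.snoc (α := fun _ => ZMod 2) p.1 (p.2 0)) = b₂} ≃
      {q : (Fin (k + 1) → ZMod 2) × (Fin (k + 1) → ZMod 2) // q.1 0 = b₁ ∧ q.2 0 = b₂} :=
    Equiv.subtypeEquiv (Equiv.ofBijective _ horth) (fun p => by
      rw [← window_eq f p.1 p.2, ← window_eq g p.1 p.2]
      rfl)
  have h := Nat.card_congr (((splitEquiv k f g b₁ b₂).symm.trans e).trans (fixEquiv k b₁ b₂))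
  rw [Nat.card_prod, Nat.card_prod] at h
  have h2 : Nat.card (Fin k → ZMod 2) = 2 ^ k := by simp
  rw [h2] at h
  exact Nat.eq_of_mul_eq_mul_right (by positivity) h
end

section
/- Let d ≥ 3. The number of ordered pairs (f, g) of bipermutive Boolean local rules f, g : F_2^d → F_2 that are pairwise balanced equals C(2^{d-2}, 2^{d-3}) · 2^{2^{d-2}}, where C(·,·) denotes the binomial coefficient. -/
namespace S11

/-- The bipermutive rule with generating function `φ`. -/
def R {m : ℕ} (φ : (Fin m → ZMod 2) → ZMod 2) : (Fin (m + 2) → ZMod 2) → ZMod 2 :=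
  fun x => x 0 + φ (fun i => x i.castSucc.succ) + x (Fin.last (m + 1))

/-- Put boundary values around a word. -/
def J {m : ℕ} (a : ZMod 2) (y : Fin m → ZMod 2) (b : ZMod 2) : Fin (m + 2) → ZMod 2 :=
  Fin.cons a (Fin.snoc y b : Fin (m + 1) → ZMod 2)

lemma J_zero {m : ℕ} (a : ZMod 2) (y : Fin m → ZMod 2) (b : ZMod 2) : J a y b 0 = a := rfl

lemma J_mid {m : ℕ} (a : ZMod 2) (y : Fin m → ZMod 2) (b : ZMod 2) (i : Fin m) :
    J a y b i.castSucc.succ = y i := by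
  unfold J
  rw [Fin.cons_succ]
  exact Fin.snoc_castSucc (α := fun _ => ZMod 2) b y i

lemma J_last {m : ℕ} (a : ZMod 2) (y : Fin m → ZMod 2) (b : ZMod 2) :
    J a y b (Fin.last (m + 1)) = b := by
  unfold J
  rw [← Fin.succ_last, Fin.cons_succ]
  exact Fin.snoc_last (α := fun _ => ZMod 2) b y

lemma ext3 {m : ℕ} {x z : Fin (m + 2) → ZMod 2} (h0 : x 0 = z 0)
    (hm : ∀ i : Fin m, x i.castSucc.succ = z i.castSucc.succ)
    (hl : x (Fin.last (m + 1)) = z (Fin.last (m + 1))) : x = z := by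
  funext i
  refine Fin.cases h0 (fun j => ?_) i
  refine Fin.lastCases ?_ (fun k => hm k) j
  rw [Fin.succ_last]; exact hl

lemma R_J {m : ℕ} (φ : (Fin m → ZMod 2) → ZMod 2) (a : ZMod 2) (y : Fin m → ZMod 2)
    (b : ZMod 2) : R φ (J a y b) = a + φ y + b := by
  simp only [R, J_zero, J_mid, J_last]

lemma R_inj {m : ℕ} : Function.Injective (R (m := m)) := by
  intro φ ψ h
  funext y
  have := congrFun h (J 0 y 0)
  simpa [R_J] using this

lemma bij2 : ∀ g : ZMod 2 → ZMod 2, Function.Bijective g → ∀ a, g a = g 0 + a := by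
  intro g hg a
  have h := hg.1.ne (show (0 : ZMod 2) ≠ 1 by decide)
  revert h
  generalize h0 : g 0 = u
  generalize h1 : g 1 = v
  have : g a = if a = 0 then u else v := by
    fin_cases a
    · exact h0
    · exact h1
  rw [this]
  clear this h0 h1 hg
  revert a u v
  decide

lemma bip_iff {m : ℕ} (f : (Fin (m + 2) → ZMod 2) → ZMod 2) (h : 2 ≤ m + 2) :
    Bipermutive h f ↔ ∃ φ, R φ = f := by
  constructor
  · rintro ⟨h0, hl⟩
    refine ⟨fun y => f (J 0 y 0), ?_⟩
    funext x
    have e1 := bij2 _ (h0 x) (x 0)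
    have e2 := bij2 _ (hl (Function.update x 0 0)) (x (Fin.last (m + 1)))
    have i0 : (⟨0, by omega⟩ : Fin (m + 2)) = 0 := rfl
    have il : (⟨m + 2 - 1, by omega⟩ : Fin (m + 2)) = Fin.last (m + 1) := rfl
    have hne : Fin.last (m + 1) ≠ 0 := (Fin.last_pos).ne'
    simp only [i0, il, Function.update_eq_self] at e1 e2
    have a1 : Function.update (Function.update x 0 0) (Fin.last (m + 1)) (x (Fin.last (m + 1)))
        = Function.update x 0 0 := by
      conv_rhs => rw [← Function.update_eq_self (Fin.last (m + 1)) (Function.update x 0 0)]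
      rw [Function.update_of_ne hne]
    have a2 : Function.update (Function.update x 0 0) (Fin.last (m + 1)) 0
        = J 0 (fun i => x i.castSucc.succ) 0 := by
      apply ext3
      · rw [J_zero, Function.update_of_ne hne.symm, Function.update_self]
      · intro i
        rw [J_mid, Function.update_of_ne, Function.update_of_ne (Fin.succ_ne_zero _)]
        rw [← Fin.succ_last]
        exact fun h => (Fin.castSucc_lt_last i).ne (Fin.succ_injective _ h)
      · rw [J_last, Function.update_self]
    rw [a1, a2] at e2
    rw [e1, e2]
    unfold R
    ring
  · rintro ⟨φ, rfl⟩
    have hne : Fin.last (m + 1) ≠ 0 := (Fin.last_pos).ne'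
    constructor
    · intro x
      refine Finite.injective_iff_bijective.1 ?_
      intro a b hab
      change R φ (Function.update x 0 a) = R φ (Function.update x 0 b) at hab
      simpa [R, Function.update_of_ne hne, Function.update_of_ne (Fin.succ_ne_zero _)] using hab
    · intro x
      refine Finite.injective_iff_bijective.1 ?_
      intro a b hab
      change R φ (Function.update x (Fin.last (m + 1)) a)
        = R φ (Function.update x (Fin.last (m + 1)) b) at hab
      have hi : ∀ i : Fin m, i.castSucc.succ ≠ Fin.last (m + 1) := by
        intro i
        rw [← Fin.succ_last]
        exact fun h => (Fin.castSucc_lt_last i).ne (Fin.succ_injective _ h)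
      unfold R at hab
      simp only [Function.update_of_ne hne.symm, Function.update_of_ne (hi _),
        Function.update_self] at hab
      exact add_left_cancel hab

lemma z1 : ∀ a p q b b₁ b₂ : ZMod 2, a + p + b = b₁ → a + q + b = b₂ → q + p = b₁ + b₂ := by
  decide
lemma z2 : ∀ a p q b₁ b₂ : ZMod 2, q + p = b₁ + b₂ →
    a + p + (b₁ + a + p) = b₁ ∧ a + q + (b₁ + a + p) = b₂ := by
  decide
lemma z3 : ∀ a p b b₁ : ZMod 2, a + p + b = b₁ → b = b₁ + a + p := by
  decide

lemma card_fib {m : ℕ} (φ ψ : (Fin m → ZMod 2) → ZMod 2) (b₁ b₂ : ZMod 2) :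
    Nat.card {x : Fin (m + 2) → ZMod 2 // R φ x = b₁ ∧ R ψ x = b₂} =
      2 * Nat.card {y : Fin m → ZMod 2 // (ψ + φ) y = b₁ + b₂} := by
  have e : (ZMod 2 × {y : Fin m → ZMod 2 // (ψ + φ) y = b₁ + b₂}) ≃
      {x : Fin (m + 2) → ZMod 2 // R φ x = b₁ ∧ R ψ x = b₂} :=
    { toFun := fun p => ⟨J p.1 p.2.1 (b₁ + p.1 + φ p.2.1), by
        rw [R_J, R_J]; exact z2 _ _ _ _ _ p.2.2⟩
      invFun := fun x => (x.1 0, ⟨fun i => x.1 i.castSucc.succ, z1 _ _ _ _ _ _ x.2.1 x.2.2⟩)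
      left_inv := by
        rintro ⟨a, y, hy⟩
        simp only [J_zero, J_mid]
      right_inv := by
        rintro ⟨x, h1, h2⟩
        apply Subtype.ext
        apply ext3
        · rfl
        · intro i; simp only [J_mid]
        · simp only [J_last]; exact (z3 _ _ _ _ h1).symm }
  rw [← Nat.card_congr e, Nat.card_prod, Nat.card_zmod]

lemma bal_iff {n : ℕ} (φ ψ : (Fin (n + 1) → ZMod 2) → ZMod 2) :
    (∀ b₁ b₂ : ZMod 2, Nat.card {x : Fin (n + 1 + 2) → ZMod 2 // R φ x = b₁ ∧ R ψ x = b₂}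
      = 2 ^ (n + 1)) ↔
    Nat.card {y : Fin (n + 1) → ZMod 2 // (ψ + φ) y = 1} = 2 ^ n := by
  simp only [card_fib, pow_succ']
  constructor
  · intro h
    have := h 0 1
    rw [zero_add] at this
    omega
  · intro h b₁ b₂
    have key : ∀ c : ZMod 2, Nat.card {y : Fin (n + 1) → ZMod 2 // (ψ + φ) y = c} = 2 ^ n := by
      have hc : Nat.card {y : Fin (n + 1) → ZMod 2 // (ψ + φ) y = 1} +
          Nat.card {y : Fin (n + 1) → ZMod 2 // ¬ (ψ + φ) y = 1} = 2 ^ (n + 1) := by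
        rw [← Nat.card_sum, Nat.card_congr (Equiv.sumCompl _)]
        simp
      have hz : ∀ c : ZMod 2, ¬ c = 1 ↔ c = 0 := by decide
      simp only [hz] at hc
      intro c
      have : c = 0 ∨ c = 1 := by revert c; decide
      rcases this with rfl | rfl
      · rw [pow_succ] at hc; omega
      · exact h
    rw [key]

lemma card_chi {Y : Type} [Fintype Y] [DecidableEq Y] (k : ℕ) :
    Nat.card {χ : Y → ZMod 2 // Nat.card {y // χ y = 1} = k} = (Fintype.card Y).choose k := by
  have e : {χ : Y → ZMod 2 // Nat.card {y // χ y = 1} = k} ≃ {s : Finset Y // s.card = k} :=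
    { toFun := fun χ => ⟨Finset.univ.filter (fun y => χ.1 y = 1), by
        have := χ.2
        rwa [Nat.card_eq_fintype_card, Fintype.card_subtype] at this⟩
      invFun := fun s => ⟨fun y => if y ∈ s.1 then 1 else 0, by
        rw [Nat.card_eq_fintype_card, Fintype.card_subtype]
        convert s.2 using 2
        ext y
        by_cases h : y ∈ s.1 <;> simp [h]⟩
      left_inv := by
        rintro ⟨χ, h⟩
        apply Subtype.ext
        funext y
        have : ∀ c : ZMod 2, (if c = 1 then (1 : ZMod 2) else 0) = c := by decide
        simpa using this (χ y)
      right_inv := by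
        rintro ⟨s, h⟩
        apply Subtype.ext
        ext y
        by_cases h : y ∈ s <;> simp [h] }
  rw [Nat.card_congr e, Nat.card_eq_fintype_card, Fintype.card_finset_len]

lemma add_add_two {Y : Type} (a b : Y → ZMod 2) : a + b + b = a := by
  funext y
  have : ∀ c d : ZMod 2, c + d + d = c := by decide
  exact this _ _

theorem main (n : ℕ) (h2 : 2 ≤ n + 1 + 2) :
    Nat.card {p : ((Fin (n + 1 + 2) → ZMod 2) → ZMod 2) × ((Fin (n + 1 + 2) → ZMod 2) → ZMod 2) //
        Bipermutive h2 p.1 ∧ Bipermutive h2 p.2 ∧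
        ∀ b₁ b₂ : ZMod 2,
          Nat.card {x : Fin (n + 1 + 2) → ZMod 2 // p.1 x = b₁ ∧ p.2 x = b₂} = 2 ^ (n + 1)} =
      Nat.choose (2 ^ (n + 1)) (2 ^ n) * 2 ^ (2 ^ (n + 1)) := by
  let F : {χ : (Fin (n + 1) → ZMod 2) → ZMod 2 // Nat.card {y // χ y = 1} = 2 ^ n} ×
      ((Fin (n + 1) → ZMod 2) → ZMod 2) →
      {p : ((Fin (n + 1 + 2) → ZMod 2) → ZMod 2) × ((Fin (n + 1 + 2) → ZMod 2) → ZMod 2) //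
        Bipermutive h2 p.1 ∧ Bipermutive h2 p.2 ∧
        ∀ b₁ b₂ : ZMod 2,
          Nat.card {x : Fin (n + 1 + 2) → ZMod 2 // p.1 x = b₁ ∧ p.2 x = b₂} = 2 ^ (n + 1)} :=
    fun q => ⟨(R q.2, R (q.1.1 + q.2)), (bip_iff _ _).2 ⟨_, rfl⟩, (bip_iff _ _).2 ⟨_, rfl⟩, by
      refine (bal_iff _ _).2 ?_
      rw [add_add_two]
      exact q.1.2⟩
  have hF : Function.Bijective F := by
    constructor
    · rintro ⟨⟨χ, hχ⟩, φ⟩ ⟨⟨χ', hχ'⟩, φ'⟩ h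
      have h' := congrArg Subtype.val h
      have h1 : φ = φ' := R_inj (congrArg Prod.fst h')
      have h3 : χ + φ = χ' + φ' := R_inj (congrArg Prod.snd h')
      subst h1
      have h4 := add_right_cancel h3
      subst h4
      rfl
    · rintro ⟨⟨f, g⟩, hf, hg, hb⟩
      obtain ⟨φ, rfl⟩ := (bip_iff _ _).1 hf
      obtain ⟨ψ, rfl⟩ := (bip_iff _ _).1 hg
      refine ⟨(⟨ψ + φ, (bal_iff _ _).1 hb⟩, φ), ?_⟩
      apply Subtype.ext
      change (R φ, R (ψ + φ + φ)) = (R φ, R ψ)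
      rw [add_add_two]
  rw [← Nat.card_congr (Equiv.ofBijective F hF), Nat.card_prod, card_chi]
  simp [Nat.card_eq_fintype_card]

end S11


/-- The number of ordered pairs of pairwise balanced bipermutive Boolean local rules of
diameter `d` equals `C(2^{d-2}, 2^{d-3}) · 2^{2^{d-2}}`. -/
theorem stmt11 {d : ℕ} (hd : 3 ≤ d) :
    Nat.card {p : ((Fin d → ZMod 2) → ZMod 2) × ((Fin d → ZMod 2) → ZMod 2) //
        Bipermutive (show 2 ≤ d by omega) p.1 ∧
        Bipermutive (show 2 ≤ d by omega) p.2 ∧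
        ∀ b₁ b₂ : ZMod 2,
          Nat.card {x : Fin d → ZMod 2 // p.1 x = b₁ ∧ p.2 x = b₂} = 2 ^ (d - 2)} =
      Nat.choose (2 ^ (d - 2)) (2 ^ (d - 3)) * 2 ^ (2 ^ (d - 2)) := by
  obtain ⟨n, rfl⟩ : ∃ n, d = n + 1 + 2 := ⟨d - 3, by omega⟩
  exact S11.main n _
end

section
/- Let d ≥ 2, k ≥ 2, and let f_1,…,f_k : F_2^d → F_2 be bipermutive local rules inducing no-boundary cellular automata F_1,…,F_k : F_2^{2(d-1)} → F_2^{d-1} that are pairwise orthogonal, i.e., for all i ≠ j the map x ↦ (F_i(x), F_j(x)) from F_2^{2(d-1)} to F_2^{d-1} × F_2^{d-1} is a bijection. Consider the map Φ : F_2^{2(d-1)} → F_2^{(k+2)(d-1)} defined by Φ(u‖v) = (u, v, F_1(u‖v), …, F_k(u‖v)) for u, v ∈ F_2^{d-1}. Then the 2^{2(d-1)} × (k+2)(d-1) binary array whose rows are the vectors Φ(x), x ∈ F_2^{2(d-1)}, is a binary orthogonal array of strength at least 2: for any two distinct column coordinates 1 ≤ i < j ≤ (k+2)(d-1) and any (b_1,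 b_2) ∈ F_2^2, the number of x ∈ F_2^{2(d-1)} such that Φ(x)_i = b_1 and Φ(x)_j = b_2 equals 2^{2(d-1)-2}. -/
/-- The map `Φ(u‖v) = (u, v, F_1(u‖v), …, F_k(u‖v))`, flattened into a row vector of
length `(k+2)(d-1)` over the alphabet: the first `2(d-1)` coordinates are the input
`x = u‖v` itself, and the remaining `k(d-1)` coordinates are the outputs of the CA. -/
def Phi {A : Type*} {k d : ℕ} (hd : 2 ≤ d) (f : Fin k → (Fin d → A) → A)
    (x : Fin (2 * (d - 1)) → A) (c : Fin ((k + 2) * (d - 1))) : A :=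
  if hc : c.1 < 2 * (d - 1) then x ⟨c.1, hc⟩
  else
    caF d
      (f ⟨(c.1 - 2 * (d - 1)) / (d - 1), by
        have hlt := c.isLt
        have hsplit : (k + 2) * (d - 1) = k * (d - 1) + 2 * (d - 1) := by ring
        rw [Nat.div_lt_iff_lt_mul (by omega : 0 < d - 1)]
        omega⟩) x
      ⟨(c.1 - 2 * (d - 1)) % (d - 1), Nat.mod_lt _ (by omega)⟩

lemma zmod2_ne {a b c : ZMod 2} (h : a ≠ b) : (a = c ↔ b = c + 1) := by
  revert a b c; decide

lemma balanced_aux {X : Type*} [Fintype X] (M : ℕ) (hX : Fintype.card X = 4 * M)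
    (φ ψ : X → ZMod 2) (g₁ g₂ : X → X) (h₁ : Function.Injective g₁) (h₂ : Function.Injective g₂)
    (a₁ : ∀ x, φ (g₁ x) ≠ φ x) (a₂ : ∀ x, φ (g₂ x) = φ x) (a₃ : ∀ x, ψ (g₂ x) ≠ ψ x)
    (b₁ b₂ : ZMod 2) : Nat.card {x : X // φ x = b₁ ∧ ψ x = b₂} = M := by
  classical
  let N : ZMod 2 → ZMod 2 → ℕ := fun b c => (Finset.univ.filter fun x => φ x = b ∧ ψ x = c).card
  let R : ZMod 2 → ℕ := fun b => (Finset.univ.filter fun x => φ x = b).card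
  have key : ∀ b c, N b c ≤ N b (c + 1) := by
    intro b c
    apply Finset.card_le_card_of_injOn g₂ _ (h₂.injOn)
    intro x hx
    simp only [Finset.coe_filter, Finset.mem_univ, true_and, Set.mem_setOf_eq] at hx ⊢
    exact ⟨(a₂ x).trans hx.1, (zmod2_ne (a₃ x).symm).1 hx.2⟩
  have keyR : ∀ b, R b ≤ R (b + 1) := by
    intro b
    apply Finset.card_le_card_of_injOn g₁ _ (h₁.injOn)
    intro x hx
    simp only [Finset.coe_filter, Finset.mem_univ, true_and, Set.mem_setOf_eq] at hx ⊢
    exact (zmod2_ne (a₁ x).symm).1 hx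
  have dich : ∀ a : ZMod 2, ¬ a = 0 ↔ a = 1 := by decide
  have sumR : ∀ b, R b = N b 0 + N b 1 := by
    intro b
    have := Finset.card_filter_add_card_filter_not (s := Finset.univ.filter fun x => φ x = b)
      (fun x => ψ x = 0)
    simp only [Finset.filter_filter, dich] at this
    exact this.symm
  have sum : R 0 + R 1 = 4 * M := by
    have := Finset.card_filter_add_card_filter_not (s := (Finset.univ : Finset X))
      (fun x => φ x = 0)
    simp only [dich] at this
    rw [← hX]; exact this
  have e : (1 + 1 : ZMod 2) = 0 := by decide
  have k0 := keyR 0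
  have k1 := keyR 1
  have k00 := key 0 0
  have k01 := key 0 1
  have k10 := key 1 0
  have k11 := key 1 1
  rw [zero_add] at k0 k00 k10
  rw [e] at k1 k01 k11
  have s0 := sumR 0
  have s1 := sumR 1
  have hN : Nat.card {x : X // φ x = b₁ ∧ ψ x = b₂} = N b₁ b₂ := by
    rw [Nat.card_eq_fintype_card, Fintype.card_subtype]
  rw [hN]
  have all : ∀ b : ZMod 2, b = 0 ∨ b = 1 := by decide
  rcases all b₁ with rfl | rfl <;> rcases all b₂ with rfl | rfl <;> omega

/-- flip one cell -/
def flipAt {m : ℕ} (s : Fin m) (x : Fin m → ZMod 2) : Fin m → ZMod 2 :=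
  Function.update x s (x s + 1)

lemma flipAt_inj {m : ℕ} (s : Fin m) : Function.Injective (flipAt s) := by
  have : Function.Involutive (flipAt s) := by
    intro x
    have e : ∀ a : ZMod 2, a + 1 + 1 = a := by decide
    simp [flipAt, e]
  exact this.injective

lemma flipAt_ne {m : ℕ} (s : Fin m) (x : Fin m → ZMod 2) : flipAt s x s ≠ x s := by
  simp [flipAt]

lemma flipAt_of_ne {m : ℕ} (s t : Fin m) (h : t ≠ s) (x : Fin m → ZMod 2) :
    flipAt s x t = x t := by
  simp [flipAt, h]

lemma caF_flip_of_out {d : ℕ} (f : (Fin d → ZMod 2) → ZMod 2) (s : Fin (2 * (d - 1)))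
    (p : Fin (d - 1)) (h : s.1 < p.1 ∨ p.1 + d ≤ s.1) (x : Fin (2 * (d - 1)) → ZMod 2) :
    caF d f (flipAt s x) p = caF d f x p := by
  unfold caF
  congr 1
  funext j
  apply flipAt_of_ne
  intro hh
  have := congrArg Fin.val hh
  have := j.isLt
  simp only at *
  omega

lemma caF_flip_ne {d : ℕ} (f : (Fin d → ZMod 2) → ZMod 2) (j : Fin d) (hf : PermutiveAt f j)
    (s : Fin (2 * (d - 1))) (p : Fin (d - 1)) (h : s.1 = p.1 + j.1)
    (x : Fin (2 * (d - 1)) → ZMod 2) :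
    caF d f (flipAt s x) p ≠ caF d f x p := by
  intro heq
  have hw : ∀ y : Fin (2 * (d - 1)) → ZMod 2, (∀ t, t ≠ s → y t = x t) →
      caF d f y p = f (Function.update (fun j : Fin d => x ⟨p.1 + j.1, by omega⟩) j (y s)) := by
    intro y hy
    unfold caF
    congr 1
    funext i
    by_cases hi : i = j
    · subst hi
      simp only [Function.update_self]
      congr 1
      exact Fin.ext h.symm
    · rw [Function.update_of_ne hi]
      apply hy
      intro hh
      have := congrArg Fin.val hh
      apply hi
      apply Fin.ext
      simp only at this
      omega
  rw [hw _ (fun t ht => flipAt_of_ne s t ht x), hw x (fun _ _ => rfl)] at heq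
  exact flipAt_ne s x ((hf _).1 heq)

lemma Phi_cases {k d : ℕ} (hd : 2 ≤ d) (f : Fin k → (Fin d → ZMod 2) → ZMod 2)
    (c : Fin ((k + 2) * (d - 1))) :
    (∃ i : Fin (2 * (d - 1)), c.1 = i.1 ∧ ∀ x, Phi hd f x c = x i) ∨
    (∃ (a : Fin k) (p : Fin (d - 1)), c.1 = 2 * (d - 1) + ((d - 1) * a.1 + p.1) ∧
      ∀ x, Phi hd f x c = caF d (f a) x p) := by
  by_cases hc : c.1 < 2 * (d - 1)
  · left
    exact ⟨⟨c.1, hc⟩, rfl, fun x => by simp [Phi, hc]⟩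
  · right
    refine ⟨⟨(c.1 - 2 * (d - 1)) / (d - 1), ?_⟩,
      ⟨(c.1 - 2 * (d - 1)) % (d - 1), Nat.mod_lt _ (by omega)⟩, ?_, ?_⟩
    · have hlt := c.isLt
      have hsplit : (k + 2) * (d - 1) = k * (d - 1) + 2 * (d - 1) := by ring
      rw [Nat.div_lt_iff_lt_mul (by omega : 0 < d - 1)]
      omega
    · simp only [Nat.div_add_mod]
      omega
    · intro x
      simp [Phi, hc]

/-- balanced pair of columns -/
def BalP {X : Type*} (M : ℕ) (φ ψ : X → ZMod 2) : Prop :=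
  ∀ b₁ b₂ : ZMod 2, Nat.card {x : X // φ x = b₁ ∧ ψ x = b₂} = M

lemma BalP.symm {X : Type*} {M : ℕ} {φ ψ : X → ZMod 2} (h : BalP M φ ψ) : BalP M ψ φ := by
  intro b₁ b₂
  rw [← h b₂ b₁]
  exact Nat.card_congr (Equiv.subtypeEquivRight fun x => and_comm)

/-- The binary array whose rows are `Φ(x) = (x, F_1(x), …, F_k(x))`, for a family of
pairwise orthogonal bipermutive CA, is a binary orthogonal array of strength at least 2:
any two distinct columns contain each pair `(b₁, b₂) ∈ F_2²` exactly `2^{2(d-1)-2}` times. -/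
theorem stmt12 {d k : ℕ} (hd : 2 ≤ d) (hk : 2 ≤ k)
    (f : Fin k → (Fin d → ZMod 2) → ZMod 2)
    (hbip : ∀ i, Bipermutive hd (f i))
    (horth : ∀ i j : Fin k, i ≠ j →
      Function.Bijective fun x : Fin (2 * (d - 1)) → ZMod 2 =>
        (caF d (f i) x, caF d (f j) x)) :
    ∀ c₁ c₂ : Fin ((k + 2) * (d - 1)), c₁ ≠ c₂ → ∀ b₁ b₂ : ZMod 2,
      Nat.card {x : Fin (2 * (d - 1)) → ZMod 2 //
          Phi hd f x c₁ = b₁ ∧ Phi hd f x c₂ = b₂} =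
        2 ^ (2 * (d - 1) - 2) := by
  have hX : Fintype.card (Fin (2 * (d - 1)) → ZMod 2) = 4 * 2 ^ (2 * (d - 1) - 2) := by
    rw [Fintype.card_fun, ZMod.card, Fintype.card_fin]
    obtain ⟨e, rfl⟩ : ∃ e, d = e + 2 := ⟨d - 2, by omega⟩
    rw [show 2 * (e + 2 - 1) = 2 * (e + 2 - 1) - 2 + 2 by omega, pow_add]
    simp [mul_comm]
  set M := 2 ^ (2 * (d - 1) - 2) with hM
  have io : ∀ (i : Fin (2 * (d - 1))) (a : Fin k) (p : Fin (d - 1)),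
      BalP M (fun x : Fin (2 * (d - 1)) → ZMod 2 => x i) (fun x => caF d (f a) x p) := by
    intro i a p
    by_cases h : i.1 = p.1
    · let s : Fin (2 * (d - 1)) := ⟨p.1 + (d - 1), by omega⟩
      refine balanced_aux M hX _ _ (flipAt i) (flipAt s) (flipAt_inj _) (flipAt_inj _)
        (flipAt_ne i) (flipAt_of_ne s i ?_) (caF_flip_ne (f a) _ (hbip a).2 s p rfl)
      intro hh
      have := congrArg Fin.val hh
      simp only [s] at this
      omega
    · let s : Fin (2 * (d - 1)) := ⟨p.1, by omega⟩
      refine balanced_aux M hX _ _ (flipAt i) (flipAt s) (flipAt_inj _) (flipAt_inj _)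
        (flipAt_ne i) (flipAt_of_ne s i ?_) (caF_flip_ne (f a) _ (hbip a).1 s p rfl)
      intro hh
      exact h (congrArg Fin.val hh)
  have same : ∀ (a : Fin k) (p q : Fin (d - 1)), p.1 < q.1 →
      BalP M (fun x => caF d (f a) x p) (fun x => caF d (f a) x q) := by
    intro a p q h
    exact balanced_aux M hX _ _ (flipAt ⟨p.1, by omega⟩) (flipAt ⟨q.1 + (d - 1), by omega⟩)
      (flipAt_inj _) (flipAt_inj _)
      (caF_flip_ne (f a) _ (hbip a).1 _ p rfl)
      (caF_flip_of_out (f a) _ p (Or.inr (by simp only; omega)))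
      (caF_flip_ne (f a) _ (hbip a).2 _ q rfl)
  have diff : ∀ (a b : Fin k) (p q : Fin (d - 1)), a ≠ b →
      BalP M (fun x => caF d (f a) x p) (fun x => caF d (f b) x q) := by
    intro a b p q h
    let e := Equiv.ofBijective _ (horth a b h)
    have ea : ∀ x, caF d (f a) x = (e x).1 := fun x => rfl
    have eb : ∀ x, caF d (f b) x = (e x).2 := fun x => rfl
    refine balanced_aux M hX _ _
      (fun x => e.symm (flipAt p (e x).1, (e x).2)) (fun x => e.symm ((e x).1, flipAt q (e x).2))
      ?_ ?_ ?_ ?_ ?_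
    · intro x y hxy
      have h := Prod.ext_iff.1 (e.symm.injective hxy)
      exact e.injective (Prod.ext (flipAt_inj _ h.1) h.2)
    · intro x y hxy
      have h := Prod.ext_iff.1 (e.symm.injective hxy)
      exact e.injective (Prod.ext h.1 (flipAt_inj _ h.2))
    · intro x
      simp only [ea, Equiv.apply_symm_apply]
      exact flipAt_ne _ _
    · intro x
      simp only [ea, Equiv.apply_symm_apply]
    · intro x
      simp only [eb, Equiv.apply_symm_apply]
      exact flipAt_ne _ _
  intro c₁ c₂ hc
  have hc' : c₁.1 ≠ c₂.1 := fun h => hc (Fin.ext h)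
  change BalP M (fun x => Phi hd f x c₁) (fun x => Phi hd f x c₂)
  rcases Phi_cases hd f c₁ with ⟨i, hi, e₁⟩ | ⟨a, p, hp, e₁⟩ <;>
  rcases Phi_cases hd f c₂ with ⟨j, hj, e₂⟩ | ⟨b, q, hq, e₂⟩ <;>
  simp only [e₁, e₂]
  · have hij : i ≠ j := fun h => hc' (by rw [hi, hj, h])
    exact balanced_aux M hX _ _ (flipAt i) (flipAt j) (flipAt_inj _) (flipAt_inj _)
      (flipAt_ne i) (flipAt_of_ne j i hij) (flipAt_ne j)
  · exact io i b q
  · exact (io j a p).symm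
  · by_cases hab : a = b
    · subst hab
      rcases lt_trichotomy p.1 q.1 with h | h | h
      · exact same a p q h
      · exact absurd (by rw [hp, hq, h]) hc'
      · exact (same a q p h).symm
    · exact diff a b p q hab
end

section
/- Let q be a prime power, d ≥ 2, n = d-1, and let F, G : F_q^{2n} → F_q^n be no-boundary cellular automata induced by linear bipermutive local rules with coefficient vectors (a_1,…,a_d) and (b_1,…,b_d) (a_1, a_d, b_1, b_d ≠ 0), whose associated polynomials p_f, p_g ∈ F_q[X] are coprime. Let M_{F,G} ∈ F_q^{2n×2n} be the Sylvester matrix of p_f and p_g (the matrix representing the bijective superposed map H(x) = (F(x), G(x)) on F_q^{2n}), which is then invertible. Then the maximum cycle length of the permutation H of F_q^{2n} equals q^{2n} - 1 if and only if the minimal polynomial of M_{F,G} is a primitive polynomial of degree 2n over F_q, i.e., it is irreducible of degree 2n and any of its roots generates the multiplicative group of F_{q^{2n}} (equivalently, the multiplicative order of X in F_q[X]/(m) is q^{2n} - 1, where m is the minimal polynomial). -/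
/-- The `2n × 2n` Sylvester matrix `M_{F,G}` of the two coefficient vectors: its `i`-th
row (`0 ≤ i < n`) is `a` shifted right by `i` positions, and its `(n+i)`-th row is `b`
shifted right by `i` positions. -/
def sylv {K : Type*} [Field K] {d : ℕ} (a b : Fin d → K) (n : ℕ) :
    Matrix (Fin (2 * n)) (Fin (2 * n)) K :=
  fun r c =>
    if r.1 < n then
      if h : r.1 ≤ c.1 ∧ c.1 - r.1 < d then a ⟨c.1 - r.1, h.2⟩ else 0
    else
      if h : r.1 - n ≤ c.1 ∧ c.1 - (r.1 - n) < d then b ⟨c.1 - (r.1 - n), h.2⟩ else 0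

section helpers

open Polynomial

theorem aux_iter {K : Type*} [Field K] {N : ℕ} (M : Matrix (Fin N) (Fin N) K) (k : ℕ)
    (x : Fin N → K) : (fun y => M.mulVec y)^[k] x = (M ^ k).mulVec x := by
  induction k with
  | zero => simp
  | succ k ih => rw [Function.iterate_succ_apply', ih, pow_succ', Matrix.mulVec_mulVec]

theorem aux_root {K : Type*} [Field K] {N : ℕ} (M : Matrix (Fin N) (Fin N) K) (k : ℕ) :
    AdjoinRoot.root (minpoly K M) ^ k = 1 ↔ M ^ k = 1 := by
  have h1 : AdjoinRoot.root (minpoly K M) ^ k = 1 ↔ minpoly K M ∣ (X ^ k - 1 : K[X]) := by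
    rw [← AdjoinRoot.mk_eq_zero]
    simp [sub_eq_zero]
  rw [h1, minpoly.dvd_iff]
  simp [sub_eq_zero]

theorem aux_order {K : Type*} [Field K] {N : ℕ} (M : Matrix (Fin N) (Fin N) K) :
    orderOf (AdjoinRoot.root (minpoly K M)) = orderOf M :=
  orderOf_eq_orderOf_iff.2 (aux_root M)

theorem aux_back {K : Type*} [Field K] {N : ℕ} (M : Matrix (Fin N) (Fin N) K)
    (hirr : Irreducible (minpoly K M)) (x : Fin N → K) (hx : x ≠ 0) :
    Function.minimalPeriod (fun y => M.mulVec y) x = orderOf M := by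
  have key : ∀ k, (M ^ k).mulVec x = x ↔ M ^ k = 1 := by
    intro k
    refine ⟨fun h => ?_, fun h => by rw [h, Matrix.one_mulVec]⟩
    by_contra hne
    have hnd : ¬ minpoly K M ∣ (X ^ k - 1 : K[X]) := by
      rw [minpoly.dvd_iff]; simpa [sub_eq_zero] using hne
    obtain ⟨u, v, huv⟩ := (hirr.coprime_iff_not_dvd).2 hnd
    have h2 := congrArg (aeval M) huv
    simp only [map_add, map_mul, minpoly.aeval, mul_zero, zero_add, map_sub, map_pow, aeval_X,
      map_one] at h2
    apply hx
    have h3 := congrArg (fun A => A.mulVec x) h2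
    simp only [← Matrix.mulVec_mulVec, Matrix.sub_mulVec, h, Matrix.one_mulVec, sub_self,
      Matrix.mulVec_zero] at h3
    exact h3.symm
  apply Nat.dvd_antisymm
  · apply Function.IsPeriodicPt.minimalPeriod_dvd
    rw [Function.IsPeriodicPt, Function.IsFixedPt, aux_iter, key]
    exact pow_orderOf_eq_one M
  · apply orderOf_dvd_of_pow_eq_one
    rw [← key, ← aux_iter]
    exact Function.isPeriodicPt_minimalPeriod _ _

theorem aux_forw {K : Type*} [Field K] [Fintype K] {N : ℕ} (hN : 2 ≤ N)
    (M : Matrix (Fin N) (Fin N) K) (x : Fin N → K)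
    (hx : Function.minimalPeriod (fun y => M.mulVec y) x = Fintype.card K ^ N - 1) :
    Irreducible (minpoly K M) ∧ (minpoly K M).natDegree = N ∧
      orderOf M = Fintype.card K ^ N - 1 := by
  classical
  set T := Fintype.card K ^ N - 1 with hT
  have hq : 2 ≤ Fintype.card K := Fintype.one_lt_card
  have hbig : 4 ≤ Fintype.card K ^ N := by
    calc 4 = 2 ^ 2 := rfl
      _ ≤ Fintype.card K ^ 2 := Nat.pow_le_pow_left hq 2
      _ ≤ _ := Nat.pow_le_pow_right (by omega) hN
  have hT3 : 3 ≤ T := by omega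
  have hper : (M ^ T).mulVec x = x := by
    rw [← aux_iter, ← hx]
    exact Function.isPeriodicPt_minimalPeriod _ _
  have hx0 : x ≠ 0 := by
    rintro rfl
    have : Function.minimalPeriod (fun y => M.mulVec y) (0 : Fin N → K) = 1 := by
      rw [Function.minimalPeriod_eq_one_iff_isFixedPt]
      simp [Function.IsFixedPt]
    omega
  -- returning
  have hret : ∀ k < T, (M ^ (T - k)).mulVec ((M ^ k).mulVec x) = x := by
    intro k hk
    rw [Matrix.mulVec_mulVec, ← pow_add, Nat.sub_add_cancel hk.le, hper]
  have horb : ∀ y : Fin N → K, y ≠ 0 → ∃ k < T, y = (M ^ k).mulVec x := by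
    let S : Finset (Fin N → K) := (Finset.range T).image fun k => (M ^ k).mulVec x
    have hScard : S.card = T := by
      rw [Finset.card_image_of_injOn, Finset.card_range]
      intro i hi j hj hij
      simp only [← aux_iter] at hij
      rw [← hx] at hi hj
      exact Function.iterate_injOn_Iio_minimalPeriod (by simpa using hi) (by simpa using hj) hij
    have hS : S = Finset.univ.erase 0 := by
      apply Finset.eq_of_subset_of_card_le
      · intro y hy
        obtain ⟨k, hk, rfl⟩ := Finset.mem_image.1 hy
        refine Finset.mem_erase.2 ⟨fun h0 => hx0 ?_, Finset.mem_univ _⟩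
        have := hret k (Finset.mem_range.1 hk)
        rw [← this]
        rw [h0, Matrix.mulVec_zero]
      · rw [hScard, Finset.card_erase_of_mem (Finset.mem_univ _), Finset.card_univ]
        simp [hT]
    intro y hy
    have : y ∈ S := by rw [hS]; simp [hy]
    obtain ⟨k, hk, h⟩ := Finset.mem_image.1 this
    exact ⟨k, Finset.mem_range.1 hk, h.symm⟩
  have hcomm : ∀ (p : K[X]) (k : ℕ), Commute (aeval M p) (M ^ k) := by
    intro p k
    have : M ^ k = aeval M (X ^ k : K[X]) := by simp
    rw [this, Commute, SemiconjBy, ← map_mul, ← map_mul, mul_comm]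
  have hker : ∀ (p : K[X]) (y : Fin N → K), y ≠ 0 → (aeval M p).mulVec y = 0 →
      aeval M p = 0 := by
    intro p y hy hpy
    obtain ⟨k, hk, rfl⟩ := horb y hy
    have hpx : (aeval M p).mulVec x = 0 := by
      rw [← hret k hk, Matrix.mulVec_mulVec, (hcomm p _).eq, ← Matrix.mulVec_mulVec, hpy,
        Matrix.mulVec_zero]
    have hall : ∀ z, (aeval M p).mulVec z = 0 := by
      intro z
      by_cases hz : z = 0
      · rw [hz, Matrix.mulVec_zero]
      · obtain ⟨j, hj, rfl⟩ := horb z hz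
        rw [Matrix.mulVec_mulVec, (hcomm p _).eq, ← Matrix.mulVec_mulVec, hpx,
          Matrix.mulVec_zero]
    ext i j
    have := congrFun (hall (Pi.single j 1)) i
    simpa using this
  have hint : IsIntegral K M := Matrix.isIntegral M
  have : Nonempty (Fin N) := ⟨⟨0, by omega⟩⟩
  have hprime : Prime (minpoly K M) := by
    refine ⟨minpoly.ne_zero hint, minpoly.not_isUnit K M, fun p r hpr => ?_⟩
    rw [minpoly.dvd_iff, map_mul] at hpr
    by_cases hr : (aeval M r).mulVec x = 0
    · right
      exact minpoly.dvd_iff.2 (hker r x hx0 hr)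
    · left
      refine minpoly.dvd_iff.2 (hker p _ hr ?_)
      rw [Matrix.mulVec_mulVec, hpr, Matrix.zero_mulVec]
  have hpow : ∀ k, (M ^ k).mulVec x = x ↔ M ^ k = 1 := by
    intro k
    refine ⟨fun h => ?_, fun h => by rw [h, Matrix.one_mulVec]⟩
    have := hker (X ^ k - 1) x hx0 (by simp [Matrix.sub_mulVec, h])
    simpa [sub_eq_zero] using this
  have hord : orderOf M = T := by
    apply Nat.dvd_antisymm
    · apply orderOf_dvd_of_pow_eq_one
      rw [← hpow, hper]
    · rw [← hx]
      apply Function.IsPeriodicPt.minimalPeriod_dvd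
      rw [Function.IsPeriodicPt, Function.IsFixedPt, aux_iter, hpow]
      exact pow_orderOf_eq_one M
  refine ⟨hprime.irreducible, ?_, hord⟩
  have hle : (minpoly K M).natDegree ≤ N := by
    have := Polynomial.natDegree_le_of_dvd (Matrix.minpoly_dvd_charpoly M)
      (Matrix.charpoly_monic M).ne_zero
    simpa [Matrix.charpoly_natDegree_eq_dim] using this
  by_contra hne
  have hlt : (minpoly K M).natDegree ≤ N - 1 := by omega
  have : Module.Finite K (AdjoinRoot (minpoly K M)) :=
    (AdjoinRoot.powerBasis (minpoly.ne_zero hint)).finite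
  have : Finite (AdjoinRoot (minpoly K M)) := Module.finite_of_finite K
  have := Fintype.ofFinite (AdjoinRoot (minpoly K M))
  have hcard : Fintype.card (AdjoinRoot (minpoly K M)) =
      Fintype.card K ^ (minpoly K M).natDegree := by
    rw [Module.card_eq_pow_finrank (K := K),
      (AdjoinRoot.powerBasis (minpoly.ne_zero hint)).finrank, AdjoinRoot.powerBasis_dim]
  have hoc : T ≤ Fintype.card (AdjoinRoot (minpoly K M)) := by
    rw [← hord, ← aux_order, ← Finset.card_range (orderOf _)]
    rw [← Finset.card_univ]
    refine Finset.card_le_card_of_injOn (fun k => AdjoinRoot.root (minpoly K M) ^ k)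
      (fun _ _ => Finset.mem_coe.2 (Finset.mem_univ _)) ?_
    intro i hi j hj hij
    exact pow_injOn_Iio_orderOf (by simpa using hi) (by simpa using hj) hij
  have h5 : T ≤ Fintype.card K ^ (N - 1) :=
    hoc.trans (hcard.le.trans (Nat.pow_le_pow_right (by omega) hlt))
  have h6 : Fintype.card K ^ N = Fintype.card K ^ (N - 1) * Fintype.card K := by
    rw [← pow_succ]; congr 1; omega
  have h7 : Fintype.card K ≤ Fintype.card K ^ (N - 1) :=
    Nat.le_self_pow (by omega) _
  have h8 : Fintype.card K ^ (N - 1) * 2 ≤ Fintype.card K ^ (N - 1) * Fintype.card K :=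
    Nat.mul_le_mul_left _ hq
  omega

theorem aux_row {K : Type*} [Field K] {d m : ℕ} (a : Fin d → K) (x : Fin m → K) (r : ℕ)
    (hr : ∀ j : Fin d, r + j.1 < m) :
    ∑ j, a j * x ⟨r + j.1, hr j⟩ =
      ∑ c : Fin m, (if h : r ≤ c.1 ∧ c.1 - r < d then a ⟨c.1 - r, h.2⟩ else 0) * x c := by
  refine Finset.sum_of_injOn (fun j => ⟨r + j.1, hr j⟩) ?_ ?_ ?_ ?_
  · intro i _ j _ h
    simp only [Fin.mk.injEq] at h
    ext; omega
  · intro i _; simp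
  · intro c _ hc
    rw [dif_neg, zero_mul]
    rintro ⟨h1, h2⟩
    apply hc
    refine ⟨⟨c.1 - r, h2⟩, by simp, ?_⟩
    ext; simp only; omega
  · intro j _
    simp

theorem aux_H {K : Type*} [Field K] {d : ℕ} (hd : 2 ≤ d) (a b : Fin d → K)
    (x : Fin (2 * (d - 1)) → K) :
    concat d (caF d (linRule a) x) (caF d (linRule b) x) = (sylv a b (d - 1)).mulVec x := by
  funext i
  have hi := i.isLt
  by_cases h : i.1 < d - 1
  · simp only [concat, caF, linRule, Matrix.mulVec, dotProduct, sylv, h, dif_pos, if_true]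
    exact aux_row a x i.1 (fun j => by have := j.isLt; omega)
  · simp only [concat, caF, linRule, Matrix.mulVec, dotProduct, sylv, h, if_false]
    exact aux_row b x (i.1 - (d - 1)) (fun j => by have := j.isLt; omega)

end helpers

/-- For two linear bipermutive CA `F, G` with coprime associated polynomials, the
superposed permutation `H(x) = (F(x), G(x))` of `F_q^{2n}` (where `n = d-1`) has
maximum cycle length `q^{2n} - 1` iff the minimal polynomial `m` of the Sylvester matrix
`M_{F,G}` is primitive of degree `2n`: `m` is irreducible of degree `2n` and the
multiplicative order of (the image of) `X` in `F_q[X]/(m)` is `q^{2n} - 1`. -/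
theorem stmt13 {K : Type*} [Field K] [Fintype K] {d : ℕ} (hd : 2 ≤ d) (q n : ℕ)
    (hq : Fintype.card K = q) (hn : n = d - 1)
    (a b : Fin d → K)
    (ha1 : a ⟨0, by omega⟩ ≠ 0) (had : a ⟨d - 1, by omega⟩ ≠ 0)
    (hb1 : b ⟨0, by omega⟩ ≠ 0) (hbd : b ⟨d - 1, by omega⟩ ≠ 0)
    (hcop : IsCoprime (assocPoly a) (assocPoly b))
    (H : (Fin (2 * (d - 1)) → K) → Fin (2 * (d - 1)) → K)
    (hH : ∀ x, H x = concat d (caF d (linRule a) x) (caF d (linRule b) x)) :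
    sSup (Set.range fun x : Fin (2 * (d - 1)) → K => Function.minimalPeriod H x) =
        q ^ (2 * n) - 1 ↔
      Irreducible (minpoly K (sylv a b (d - 1))) ∧
      (minpoly K (sylv a b (d - 1))).natDegree = 2 * n ∧
      orderOf (AdjoinRoot.root (minpoly K (sylv a b (d - 1)))) = q ^ (2 * n) - 1 := by
  subst hn hq
  have hHM : H = fun y => (sylv a b (d - 1)).mulVec y := by
    funext x
    rw [hH, aux_H hd]
  rw [aux_order]
  subst hHM
  have hN : 2 ≤ 2 * (d - 1) := by omega
  clear hH
  generalize sylv a b (d - 1) = M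
  generalize 2 * (d - 1) = N at M hN
  have hfin : (Set.range fun x : Fin N → K =>
      Function.minimalPeriod (fun y => M.mulVec y) x).Finite := Set.finite_range _
  constructor
  · intro h
    obtain ⟨x, hx⟩ := Nat.sSup_mem (Set.range_nonempty _) hfin.bddAbove
    exact aux_forw hN M x (hx.trans h)
  · rintro ⟨hirr, -, hord⟩
    have h1 : 1 ≤ Fintype.card K ^ N - 1 := by
      have : 1 < Fintype.card K ^ N := Nat.one_lt_pow (by omega) Fintype.one_lt_card
      omega
    refine IsGreatest.csSup_eq ⟨⟨fun _ => 1, ?_⟩, ?_⟩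
    · rw [← hord]
      refine aux_back M hirr _ fun h => ?_
      exact one_ne_zero (congrFun h ⟨0, by omega⟩)
    · rintro _ ⟨x, rfl⟩
      by_cases hx : x = 0
      · subst hx
        have : Function.minimalPeriod (fun y => M.mulVec y) (0 : Fin N → K) = 1 := by
          rw [Function.minimalPeriod_eq_one_iff_isFixedPt]
          simp [Function.IsFixedPt]
        simpa [this] using h1
      · exact ((aux_back M hirr x hx).trans hord).le
end

section
/- Let Σ be a finite alphabet, d ≥ 2, and let f : Σ^d → Σ be a local rule inducing the no-boundary cellular automaton F : Σ^{2(d-1)} → Σ^{d-1}. Define the binary operation ∗ on Σ^{d-1} by u ∗ v = F(u‖v). If (Σ^{d-1}, ∗) is a monoid (∗ is associative and has a two-sided identity element), then the local rule f depends only on its leftmost and rightmost cells: there exists a function h : Σ × Σ → Σ such that f(x_1, x_2, …, x_d) = h(x_1, x_d) for all (x_1,…,x_d) ∈ Σ^d. -/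
/-- The block operation of the CA induced by `f`: `u ∗ v = F(u‖v)`. -/
def blockOp {A : Type*} (d : ℕ) (f : (Fin d → A) → A) (u v : Fin (d - 1) → A) :
    Fin (d - 1) → A :=
  caF d f (concat d u v)

/-- If the block operation `u ∗ v = F(u‖v)` of the CA induced by a local rule `f` of
diameter `d` over a finite alphabet is a monoid operation (associative with a two-sided
identity), then `f` depends only on its leftmost and rightmost cells. -/
theorem stmt15 {A : Type*} [Fintype A] {d : ℕ} (hd : 2 ≤ d)
    (f : (Fin d → A) → A)
    (hassoc : ∀ u v w : Fin (d - 1) → A,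
      blockOp d f (blockOp d f u v) w = blockOp d f u (blockOp d f v w))
    (hid : ∃ e : Fin (d - 1) → A,
      ∀ u : Fin (d - 1) → A, blockOp d f e u = u ∧ blockOp d f u e = u) :
    ∃ h : A → A → A, ∀ x : Fin d → A,
      f x = h (x ⟨0, by omega⟩) (x ⟨d - 1, by omega⟩) := by
  obtain ⟨e, he⟩ := hid
  have hn : 0 < d - 1 := by omega
  let G : (Fin (d - 1) → A) → A → A := fun u b =>
    f fun j => if h : j.1 < d - 1 then u ⟨j.1, h⟩ else b
  have H0 : ∀ u v, blockOp d f u v ⟨0, hn⟩ = G u (v ⟨0, hn⟩) := by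
    intro u v
    simp only [blockOp, caF, G]
    congr 1
    funext j
    have hj := j.isLt
    simp only [concat, Nat.zero_add]
    split_ifs with h
    · rfl
    · congr 1
      apply Fin.ext
      simp only
      omega
  have H1 : ∀ u v b, G (blockOp d f u v) b = G u (G v b) := by
    intro u v b
    have h := congrFun (hassoc u v (fun _ => b)) ⟨0, hn⟩
    rw [H0, H0, H0] at h
    exact h
  have I2 : ∀ u, G u (e ⟨0, hn⟩) = u ⟨0, hn⟩ := by
    intro u
    rw [← H0, (he u).2]
  have I3 : ∀ u b, u ⟨0, hn⟩ = e ⟨d - 2, by omega⟩ → G u b = b := by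
    intro u b hu
    have h := congrFun (he (fun i => if h : i.1 + 1 < d - 1 then u ⟨i.1 + 1, h⟩ else b)).1
      ⟨d - 2, by omega⟩
    have h2 : ¬ (d - 2 + 1 < d - 1) := by omega
    simp only [h2, dite_false] at h
    rw [← h]
    simp only [G]
    rw [h]
    simp only [blockOp, caF] at h
    conv_rhs => rw [← h]
    congr 1
    funext j
    have hj := j.isLt
    simp only [concat]
    by_cases hj0 : j.1 = 0
    · have h3 : d - 2 + j.1 < d - 1 := by omega
      have h4 : j.1 < d - 1 := by omega
      simp only [h3, h4, dite_true]
      have e1 : (⟨j.1, h4⟩ : Fin (d - 1)) = ⟨0, hn⟩ := Fin.ext hj0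
      have e2 : (⟨d - 2 + j.1, h3⟩ : Fin (d - 1)) = ⟨d - 2, by omega⟩ :=
        Fin.ext (by simp only; omega)
      rw [e1, e2, hu]
    · have h3 : ¬ (d - 2 + j.1 < d - 1) := by omega
      have h5 : d - 2 + j.1 - (d - 1) + 1 = j.1 := by omega
      simp only [h3, dite_false, h5]
  have I4 : ∀ v b, v ⟨0, hn⟩ = e ⟨0, hn⟩ → G v b = b := by
    intro v b hv
    obtain ⟨w, hw⟩ : ∃ w : Fin (d - 1) → A, w ⟨0, hn⟩ = e ⟨d - 2, by omega⟩ :=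
      ⟨fun _ => e ⟨d - 2, by omega⟩, rfl⟩
    have h := H1 w v b
    rw [I3 _ b (by rw [H0, hv, I2, hw]), I3 w (G v b) hw] at h
    exact h.symm
  refine ⟨fun a b => G (fun i => if i.1 = 0 then a else e i) b, fun x => ?_⟩
  let v : Fin (d - 1) → A := fun i => if i.1 = 0 then e i else x ⟨i.1, by omega⟩
  let u : Fin (d - 1) → A := fun i => if i.1 = 0 then x ⟨0, by omega⟩ else e i
  have hv : v ⟨0, hn⟩ = e ⟨0, hn⟩ := by simp [v]
  have h := H1 u v (x ⟨d - 1, by omega⟩)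
  rw [I4 v _ hv] at h
  refine Eq.trans ?_ h
  have huv : ∀ i : Fin (d - 1), blockOp d f u v i = x ⟨i.1, by omega⟩ := by
    intro i
    by_cases hi : i.1 = 0
    · obtain rfl : i = ⟨0, hn⟩ := Fin.ext hi
      rw [H0, hv, I2]
      simp [u]
    · have h6 : blockOp d f u v i = blockOp d f e v i := by
        simp only [blockOp, caF]
        congr 1
        funext j
        simp only [concat]
        split_ifs with h7
        · have h8 : ¬ (i.1 + j.1 = 0) := by omega
          simp only [u, h8, if_false]
        · rfl
      rw [h6, (he v).1]
      simp only [v, hi, if_false]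
  simp only [G]
  congr 1
  funext j
  have hj := j.isLt
  split_ifs with h9
  · rw [huv]
  · congr 1
    apply Fin.ext
    simp only
    omega
end
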